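/- Let $\Theta\subset\mathbb R$ be an interval and let $(P_\theta)_{\theta\in\Theta}$ be a family of probability measures under which random variables $X_1,X_2,\dots$ are defined such that, for every $\theta\in\Theta$ and $i\ge 1$, the variable $X_i$ has, under $P_\theta$, the conditional probability density (or mass) function $f(x_i\mid x_{i-1},\dots,x_{\max(i-m,1)};\theta)$ given $X_{i-1},\dots,X_{\max(i-m,1)}$ (for $i=1$ the unconditional one, $f(x_1;\theta)$), with respect to a fixed $\sigma$-finite reference measure on $\mathbb R$. Let $\theta_0\in\Theta$ be the true parameter; $\mathrm E$ and $\mathrm{Var}$ are taken under $P_{\theta_0}$. Assume that, under $P_{\theta_0}$, the $X_i$ are identically distributed and $m$-dependent, i.e. $\{X_j:j\le i\}$ and $\{X_j:j>i+m\}$ are independent for every $i$. Fix $n\ge1$ and put $X=(X_1,\dots,X_n)$. Let $L(\theta;x)=f(x_1;\theta)\prod_{i=2}^n f(x_i\mid x_{i-1},\dots,x_{\max(i-m,1)};\theta)$ and $l(\theta;x)=\log f(x_1;\theta)+\sum_{i=2}^n\log f(x_i\mid x_{i-1},\dots,x_{\max(i-m,1)};\theta)$ be the likelihood and the log-likelihood;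 primes and $l^{(3)}$ denote derivatives in $\theta\in\Theta$ (one-sided at an end point of $\Theta$ that belongs to $\Theta$). Assume that the support $S=\{x\in\mathbb R^n: L(\theta;x)>0\}$ does not depend on $\theta\in\Theta$. Assume that, $P_{\theta_0}$-almost surely, the maximum likelihood estimator $\hat\theta_n(X)$ (the maximizer of $L(\cdot\,;X)$ over $\Theta$) exists, is unique and satisfies $l'(\hat\theta_n(X);X)=0$, and that for all sufficiently large sample sizes $N$ the maximum likelihood estimator $\hat\theta_N(X)$ based on $X_1,\dots,X_N$ almost surely exists and is unique. Assume further: * (A.D.1) for every $x\in S$, $l(\cdot\,;x)$ is three times differentiable on $\Theta$, and $S_d(n):=\sup_{\theta\in\Theta,\,x\in S}|l^{(3)}(\theta;x)|<\infty$; * (A.D.2) the score terms $\tilde\xi_1=\frac{d}{d\theta}\log f(X_1;\theta)\big|_{\theta=\theta_0}$ and $\tilde\xi_i=\frac{d}{d\theta}\log f(X_i\mid X_{i-1},\dots,X_{\max(i-m,1)};\theta)\big|_{\theta=\theta_0}$, $2\le i\le n$, exist almost surely, are integrable and have mean zero; * (A.D.4) the limit $i_2(\theta_0):=\lim_{N\to\infty}\frac{1}{N\,\mathrm{Var}(\hat\theta_N(X))}$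 exists and is positive; * $\mathrm{Var}[l'(\theta_0;X)]>0$, and $\alpha:=\sqrt{\mathrm{Var}(l'(\theta_0;X))/\mathrm{Var}(\hat\theta_n(X))}$ is finite and nonzero, both variances being finite. Set $\xi_i=\tilde\xi_i\sqrt{n/\mathrm{Var}(l'(\theta_0;X))}$, $A_i=\{\max(1,i-2m),\dots,\min(n,i+2m)\}$ and $B_i=\{\max(1,i-4m),\dots,\min(n,i+4m)\}$. For real random variables $F,G$ let $d_W(F,G)=\sup\{|\mathrm E[h(F)]-\mathrm E[h(G)]|: h:\mathbb R\to\mathbb R \text{ Lipschitz with constant } 1\}$. Then, for $Z$ standard normal, and with all expectations on the right-hand side taken in $[0,\infty]$ (with $0\cdot\infty=0$), \begin{align*} d_W\big(\sqrt{n\,i_2(\theta_0)}\,(\hat\theta_n(X)-\theta_0),Z\big) &\le \frac{2}{n^{3/2}}\sum_{i=1}^n\sum_{j\in A_i}\sum_{k\in B_i}\big[\mathrm E(\xi_i^4)\,\mathrm E(\xi_j^4)\,\mathrm E(\xi_k^4)\big]^{1/4}\\ &\quad+\frac{2}{n^{3/2}}\sum_{i=1}^n\sum_{j\in A_i}\sum_{k\in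 B_i}\big[\mathrm E(\xi_i^2)\,\mathrm E(\xi_j^2)\,\mathrm E(\xi_k^2)\big]^{1/2} +\frac{1}{n^{3/2}}\sum_{i=1}^n|A_i|\sum_{j\in A_i}\big[\mathrm E(\xi_i^2)\,\mathrm E(\xi_j^4)\big]^{1/2}\\ &\quad+\left|\frac{\sqrt{n\,i_2(\theta_0)\,\mathrm{Var}[l'(\theta_0;X)]}}{\alpha}-1\right| +\frac{S_d(n)\sqrt{n\,i_2(\theta_0)}}{2\alpha}\,\mathrm E\big[(\hat\theta_n(X)-\theta_0)^2\big]\\ &\quad+\frac{\sqrt{n\,i_2(\theta_0)}}{\alpha}\sqrt{\mathrm E\big[(\hat\theta_n(X)-\theta_0)^2\big]}\,\sqrt{\mathrm E\big[(l''(\theta_0;X)+\alpha)^2\big]}. \end{align*} -/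

import Mathlib

open MeasureTheory ProbabilityTheory Filter Topology
open scoped ENNReal

noncomputable section

namespace MDepMLE

/-- The Wasserstein distance between two laws on `ℝ`: the supremum, in `[0, ∞]`, of
`|E h(F) - E h(G)|` over all `1`-Lipschitz functions `h`. -/
def wassersteinDist (μ ν : Measure ℝ) : ℝ≥0∞ :=
  ⨆ (h : ℝ → ℝ) (_ : LipschitzWith 1 h), ENNReal.ofReal |(∫ x, h x ∂μ) - ∫ x, h x ∂ν|

/-- The sequence `X 1, X 2, …` (the entry `X 0` plays no role) is `m`-dependent:
for every `i`, `{X j : j ≤ i}` and `{X j : j > i + m}` are independent. -/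
def IsMDependent {Ω : Type*} [MeasurableSpace Ω] (X : ℕ → Ω → ℝ) (m : ℕ) (μ : Measure Ω) :
    Prop :=
  ∀ i : ℕ, IndepFun (fun ω (j : Set.Icc 1 i) => X j ω) (fun ω (j : Set.Ioi (i + m)) => X j ω) μ

/-- `g` is a conditional density of `X` given `Y` with respect to the reference measure `ν`
(Lebesgue measure for densities, a counting measure for mass functions): the joint law of
`(Y, X)` has density `(y, x) ↦ g y x` with respect to the product of the law of `Y` and `ν`. -/
structure IsCondDensity {Ω E : Type*} [MeasurableSpace Ω] [MeasurableSpace E]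
    (μ : Measure Ω) (ν : Measure ℝ) (Y : Ω → E) (X : Ω → ℝ) (g : E → ℝ → ℝ) : Prop where
  nonneg : ∀ y x, 0 ≤ g y x
  measurable : Measurable (Function.uncurry g)
  map_eq : μ.map (fun ω => (Y ω, X ω)) =
    ((μ.map Y).prod ν).withDensity fun p => ENNReal.ofReal (g p.1 p.2)

/-- The indices `max (i - m) 1, …, i - 1` on which the `i`-th conditional density is
conditioned; empty for `i = 1`, and empty for all `i` if `m = 0`. -/
def past (m i : ℕ) : Finset ℕ := Finset.Ico (max (i - m) 1) i

/-- A family of conditional densities: `f i θ y x` stands for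
`f(x_i | x_{i-1}, …, x_{max(i-m,1)}; θ)` with `x = x_i` and `y` the vector of past values. -/
abbrev CondDensities (m : ℕ) : Type :=
  (i : ℕ) → ℝ → (past m i → ℝ) → ℝ → ℝ

variable {m : ℕ}

/-- `f(x_i | x_{i-1}, …, x_{max(i-m,1)}; θ)` along a sequence `x = (x_1, x_2, …)`. -/
def condTerm (f : CondDensities m) (i : ℕ) (θ : ℝ) (x : ℕ → ℝ) : ℝ :=
  f i θ ((past m i).restrict x) (x i)

/-- The likelihood `L(θ; x_1, …, x_n)`; only the coordinates `1, …, n` of `x` enter. -/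
def likelihood (f : CondDensities m) (n : ℕ) (θ : ℝ) (x : ℕ → ℝ) : ℝ :=
  ∏ i ∈ Finset.Icc 1 n, condTerm f i θ x

/-- The log-likelihood `l(θ; x_1, …, x_n)`. -/
def logLik (f : CondDensities m) (n : ℕ) (θ : ℝ) (x : ℕ → ℝ) : ℝ :=
  ∑ i ∈ Finset.Icc 1 n, Real.log (condTerm f i θ x)

/-- The `k`-th derivative of the log-likelihood in `θ`, for `θ` in the parameter space `Θ`.
At interior points of `Θ` this is the ordinary derivative, at an end point that belongs to
`Θ` it is the one-sided one. -/
def logLikDeriv (f : CondDensities m) (Θ : Set ℝ) (n k : ℕ) (θ : ℝ) (x : ℕ → ℝ) : ℝ :=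
  iteratedDerivWithin k (fun t => logLik f n t x) Θ θ

/-- The score term `(d/dθ) log f(x_i | x_{i-1}, …, x_{max(i-m,1)}; θ)`. -/
def scoreTerm (f : CondDensities m) (Θ : Set ℝ) (i : ℕ) (θ : ℝ) (x : ℕ → ℝ) : ℝ :=
  derivWithin (fun t => Real.log (condTerm f i t x)) Θ θ

/-- The support of the joint density of `x_1, …, x_n` at the parameter `θ`, written as a set
of sequences (a cylinder over the coordinates `1, …, n`). -/
def jointSupport (f : CondDensities m) (n : ℕ) (θ : ℝ) : Set (ℕ → ℝ) :=
  {x | 0 < likelihood f n θ x}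

/-- `S_d(n)`, the supremum of `|l⁽³⁾(θ; x)|` over `θ ∈ Θ` and `x ∈ S`, in `[0, ∞]`. -/
def supThirdDeriv (f : CondDensities m) (Θ : Set ℝ) (S : Set (ℕ → ℝ)) (n : ℕ) : ℝ≥0∞ :=
  ⨆ θ ∈ Θ, ⨆ x ∈ S, ENNReal.ofReal |logLikDeriv f Θ n 3 θ x|

/-- `t` is the unique maximizer over `Θ` of the likelihood of the observations
`x_1, …, x_n`. -/
def IsUniqueMLE (f : CondDensities m) (Θ : Set ℝ) (n : ℕ) (x : ℕ → ℝ) (t : ℝ) : Prop :=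
  t ∈ Θ ∧ IsMaxOn (fun θ => likelihood f n θ x) Θ t ∧
    ∀ t' ∈ Θ, IsMaxOn (fun θ => likelihood f n θ x) Θ t' → t' = t

/-- `{max(1, i - r), …, min(n, i + r)}`. -/
def nbhd (n r i : ℕ) : Finset ℕ := Finset.Icc (max 1 (i - r)) (min n (i + r))

/-- The expectation, in `[0, ∞]`, of a nonnegative random variable. -/
def eexp {Ω : Type*} [MeasurableSpace Ω] (μ : Measure Ω) (Y : Ω → ℝ) : ℝ≥0∞ :=
  ∫⁻ ω, ENNReal.ofReal (Y ω) ∂μ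

end MDepMLE

end

namespace MDepMLE

/-- The unnormalized standard Gaussian density. -/
noncomputable def gaussKernel (x : ℝ) : ℝ := Real.exp (-x ^ 2 / 2)

theorem gaussKernel_pos (x : ℝ) : 0 < gaussKernel x := Real.exp_pos _

theorem hasDerivAt_gaussKernel (x : ℝ) : HasDerivAt gaussKernel (-x * gaussKernel x) x := by
  have h : HasDerivAt (fun x : ℝ => -x ^ 2 / 2) (-x) x := by
    refine (((hasDerivAt_pow 2 x).neg).div_const 2).congr_deriv ?_
    norm_num
    ring
  refine h.exp.congr_deriv ?_
  rw [mul_comm]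
  rfl

theorem continuous_gaussKernel : Continuous gaussKernel := by
  unfold gaussKernel; fun_prop

theorem integrable_pow_mul_gaussKernel (k : ℕ) :
    Integrable (fun x : ℝ => x ^ k * gaussKernel x) := by
  have := integrable_rpow_mul_exp_neg_mul_sq (b := 1 / 2) (by norm_num) (s := k)
    (by have : (0 : ℝ) ≤ k := Nat.cast_nonneg k
        linarith)
  refine this.congr (ae_of_all _ fun x => ?_)
  simp only [Real.rpow_natCast, gaussKernel]
  ring_nf

theorem integrable_gaussKernel : Integrable gaussKernel := by
  simpa using integrable_pow_mul_gaussKernel 0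

theorem integrable_id_mul_gaussKernel : Integrable (fun x : ℝ => x * gaussKernel x) := by
  simpa using integrable_pow_mul_gaussKernel 1

theorem integral_Ioi_id_mul_gaussKernel (w : ℝ) :
    ∫ x in Set.Ioi w, x * gaussKernel x = gaussKernel w := by
  have hd : ∀ x, HasDerivAt (fun x => -gaussKernel x) (x * gaussKernel x) x := fun x =>
    (hasDerivAt_gaussKernel x).neg.congr_deriv (by ring)
  have h0 := tendsto_zero_of_hasDerivAt_of_integrableOn_Ioi (a := w) (fun x _ => hd x)
    integrable_id_mul_gaussKernel.integrableOn integrable_gaussKernel.neg.integrableOn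
  rw [integral_Ioi_of_hasDerivAt_of_tendsto' (fun x _ => hd x)
    integrable_id_mul_gaussKernel.integrableOn h0]
  ring

theorem integral_Iic_id_mul_gaussKernel (w : ℝ) :
    ∫ x in Set.Iic w, x * gaussKernel x = -gaussKernel w := by
  have hd : ∀ x, HasDerivAt (fun x => -gaussKernel x) (x * gaussKernel x) x := fun x =>
    (hasDerivAt_gaussKernel x).neg.congr_deriv (by ring)
  have h0 := tendsto_zero_of_hasDerivAt_of_integrableOn_Iic (a := w) (fun x _ => hd x)
    integrable_id_mul_gaussKernel.integrableOn integrable_gaussKernel.neg.integrableOn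
  rw [integral_Iic_of_hasDerivAt_of_tendsto' (fun x _ => hd x)
    integrable_id_mul_gaussKernel.integrableOn h0]
  ring

theorem hasDerivAt_neg_id_mul_gaussKernel (x : ℝ) :
    HasDerivAt (fun x => -(x * gaussKernel x)) (x ^ 2 * gaussKernel x - gaussKernel x) x := by
  refine ((hasDerivAt_id x).mul (hasDerivAt_gaussKernel x)).neg.congr_deriv ?_
  simp only [id]
  ring

theorem integral_Ioi_sq_mul_gaussKernel (w : ℝ) :
    ∫ x in Set.Ioi w, x ^ 2 * gaussKernel x
      = w * gaussKernel w + ∫ x in Set.Ioi w, gaussKernel x := by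
  have hi := (integrable_pow_mul_gaussKernel 2).sub integrable_gaussKernel
  have h0 := tendsto_zero_of_hasDerivAt_of_integrableOn_Ioi (a := w)
    (fun x _ => hasDerivAt_neg_id_mul_gaussKernel x)
    hi.integrableOn integrable_id_mul_gaussKernel.neg.integrableOn
  have h := integral_Ioi_of_hasDerivAt_of_tendsto' (a := w)
    (fun x _ => hasDerivAt_neg_id_mul_gaussKernel x) hi.integrableOn h0
  rw [integral_sub (integrable_pow_mul_gaussKernel 2).integrableOn
    integrable_gaussKernel.integrableOn] at h
  linarith

theorem integral_Iic_sq_mul_gaussKernel (w : ℝ) :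
    ∫ x in Set.Iic w, x ^ 2 * gaussKernel x
      = -(w * gaussKernel w) + ∫ x in Set.Iic w, gaussKernel x := by
  have hi := (integrable_pow_mul_gaussKernel 2).sub integrable_gaussKernel
  have h0 := tendsto_zero_of_hasDerivAt_of_integrableOn_Iic (a := w)
    (fun x _ => hasDerivAt_neg_id_mul_gaussKernel x)
    hi.integrableOn integrable_id_mul_gaussKernel.neg.integrableOn
  have h := integral_Iic_of_hasDerivAt_of_tendsto' (a := w)
    (fun x _ => hasDerivAt_neg_id_mul_gaussKernel x) hi.integrableOn h0
  rw [integral_sub (integrable_pow_mul_gaussKernel 2).integrableOn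
    integrable_gaussKernel.integrableOn] at h
  linarith

/-- The integral of `(x - w)² e^{-x²/2}` over a set, expanded. -/
theorem setIntegral_sub_sq_mul_gaussKernel (s : Set ℝ) (w : ℝ) :
    ∫ x in s, (x - w) ^ 2 * gaussKernel x
      = (∫ x in s, x ^ 2 * gaussKernel x) - 2 * w * (∫ x in s, x * gaussKernel x)
        + w ^ 2 * ∫ x in s, gaussKernel x := by
  rw [← integral_const_mul, ← integral_const_mul, ← integral_sub, ← integral_add]
  · congr 1 with x
    ring
  · exact ((integrable_pow_mul_gaussKernel 2).sub
      (integrable_id_mul_gaussKernel.const_mul _)).integrableOn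
  · exact (integrable_gaussKernel.const_mul _).integrableOn
  · exact (integrable_pow_mul_gaussKernel 2).integrableOn
  · exact (integrable_id_mul_gaussKernel.const_mul _).integrableOn

/-- The lower Mills ratio bound on the right tail. -/
theorem mul_gaussKernel_le_integral_Ioi (w : ℝ) :
    w * gaussKernel w ≤ (1 + w ^ 2) * ∫ x in Set.Ioi w, gaussKernel x := by
  have h := setIntegral_sub_sq_mul_gaussKernel (Set.Ioi w) w
  have h0 : 0 ≤ ∫ x in Set.Ioi w, (x - w) ^ 2 * gaussKernel x :=
    integral_nonneg fun x => mul_nonneg (sq_nonneg _) (gaussKernel_pos x).le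
  rw [integral_Ioi_sq_mul_gaussKernel, integral_Ioi_id_mul_gaussKernel] at h
  linarith

/-- The lower Mills ratio bound on the left tail. -/
theorem neg_mul_gaussKernel_le_integral_Iic (w : ℝ) :
    -(w * gaussKernel w) ≤ (1 + w ^ 2) * ∫ x in Set.Iic w, gaussKernel x := by
  have h := setIntegral_sub_sq_mul_gaussKernel (Set.Iic w) w
  have h0 : 0 ≤ ∫ x in Set.Iic w, (x - w) ^ 2 * gaussKernel x :=
    integral_nonneg fun x => mul_nonneg (sq_nonneg _) (gaussKernel_pos x).le
  rw [integral_Iic_sq_mul_gaussKernel, integral_Iic_id_mul_gaussKernel] at h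
  linarith

theorem integral_gaussianReal_eq_integral_gaussKernel (h : ℝ → ℝ) :
    ∫ x, h x ∂(gaussianReal 0 1) = (√(2 * Real.pi))⁻¹ * ∫ x, h x * gaussKernel x := by
  rw [integral_gaussianReal_eq_integral_smul (by norm_num), ← integral_const_mul]
  congr 1 with x
  simp [gaussianPDFReal, gaussKernel]
  ring

theorem integral_gaussKernel : ∫ x, gaussKernel x = √(2 * Real.pi) := by
  have h := integral_gaussianReal_eq_integral_gaussKernel fun _ => 1
  simp only [integral_const, probReal_univ, smul_eq_mul, one_mul] at h
  have : 0 < √(2 * Real.pi) := by positivity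
  field_simp at h
  linarith

theorem abs_sub_le_of_lipschitz {h : ℝ → ℝ} (hh : LipschitzWith 1 h) (x y : ℝ) :
    |h x - h y| ≤ |x - y| := by
  simpa [Real.dist_eq] using hh.dist_le_mul x y

theorem integrable_lipschitz_sub_mul_gaussKernel {h : ℝ → ℝ} (hh : LipschitzWith 1 h) (c : ℝ) :
    Integrable (fun x => (h x - c) * gaussKernel x) := by
  have hm : AEStronglyMeasurable (fun x => (h x - c) * gaussKernel x) volume :=
    ((hh.continuous.sub continuous_const).mul continuous_gaussKernel).aestronglyMeasurable
  refine Integrable.mono' (integrable_id_mul_gaussKernel.norm.add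
    (integrable_gaussKernel.const_mul |h 0 - c|)) hm (ae_of_all _ fun x => ?_)
  have h1 := abs_sub_le_of_lipschitz hh x 0
  have h2 : |h x - c| ≤ |x| + |h 0 - c| := by
    have := abs_sub_le (h x) (h 0) c
    simp only [sub_zero] at h1
    linarith
  simp only [Real.norm_eq_abs, abs_mul, abs_of_pos (gaussKernel_pos x), Pi.add_apply]
  nlinarith [gaussKernel_pos x]

theorem integral_sub_gaussian_mean_mul_gaussKernel {h : ℝ → ℝ} (hh : LipschitzWith 1 h) :
    ∫ x, (h x - ∫ z, h z ∂(gaussianReal 0 1)) * gaussKernel x = 0 := by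
  have hi : Integrable (fun x => h x * gaussKernel x) := by
    simpa using integrable_lipschitz_sub_mul_gaussKernel hh 0
  simp only [sub_mul]
  rw [integral_sub hi (integrable_gaussKernel.const_mul _), integral_const_mul,
    integral_gaussKernel, integral_gaussianReal_eq_integral_gaussKernel]
  have : 0 < √(2 * Real.pi) := by positivity
  field_simp
  ring

/-- The solution of the Stein equation for the test function `h`. -/
noncomputable def steinSol (h : ℝ → ℝ) (w : ℝ) : ℝ :=
  (gaussKernel w)⁻¹ * ∫ x in Set.Iic w, (h x - ∫ z, h z ∂(gaussianReal 0 1)) * gaussKernel x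

theorem hasDerivAt_integral_Iic {g : ℝ → ℝ} (hg : Continuous g) (hi : Integrable g) (w : ℝ) :
    HasDerivAt (fun w => ∫ x in Set.Iic w, g x) (g w) w := by
  have h1 : (fun w => ∫ x in Set.Iic w, g x)
      = fun w => (∫ x in Set.Iic 0, g x) + ∫ x in (0 : ℝ)..w, g x := by
    funext w
    rw [← intervalIntegral.integral_Iic_sub_Iic hi.integrableOn hi.integrableOn]
    ring
  rw [h1]
  exact (intervalIntegral.integral_hasDerivAt_right hi.intervalIntegrable
    hg.stronglyMeasurable.stronglyMeasurableAtFilter hg.continuousAt).const_add _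

theorem hasDerivAt_steinSol {h : ℝ → ℝ} (hh : LipschitzWith 1 h) (w : ℝ) :
    HasDerivAt (steinSol h) (w * steinSol h w + (h w - ∫ z, h z ∂(gaussianReal 0 1))) w := by
  have h1 := (hasDerivAt_gaussKernel w).inv (gaussKernel_pos w).ne'
  have h2 := hasDerivAt_integral_Iic
    (g := fun x => (h x - ∫ z, h z ∂(gaussianReal 0 1)) * gaussKernel x)
    ((hh.continuous.sub continuous_const).mul continuous_gaussKernel)
    (integrable_lipschitz_sub_mul_gaussKernel hh _) w
  refine (h1.mul h2).congr_deriv ?_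
  have := (gaussKernel_pos w).ne'
  simp only [steinSol, Pi.inv_apply]
  field_simp

/-- The derivative of `w ↦ w f(w)`, where `f` solves the Stein equation of a `1`-Lipschitz
function, is bounded by `1`. -/
theorem abs_deriv_id_mul_steinSol_le {h : ℝ → ℝ} (hh : LipschitzWith 1 h) (w : ℝ) :
    |(1 + w ^ 2) * steinSol h w + w * (h w - ∫ z, h z ∂(gaussianReal 0 1))| ≤ 1 := by
  set N := ∫ z, h z ∂(gaussianReal 0 1) with hN
  set p := gaussKernel w with hp
  have hp0 : 0 < p := gaussKernel_pos w
  set I := ∫ x in Set.Iic w, gaussKernel x with hI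
  set J := ∫ x in Set.Ioi w, gaussKernel x with hJ
  have hIJ : I + J = ∫ x, gaussKernel x :=
    intervalIntegral.integral_Iic_add_Ioi integrable_gaussKernel.integrableOn
      integrable_gaussKernel.integrableOn
  have hIJ0 : 0 < I + J := by
    rw [hIJ, integral_gaussKernel]; positivity
  have hk := integrable_lipschitz_sub_mul_gaussKernel hh (h w)
  set K₁ := ∫ x in Set.Iic w, (h x - h w) * gaussKernel x with hK₁
  set K₂ := ∫ x in Set.Ioi w, (h x - h w) * gaussKernel x with hK₂
  have hsplit : ∀ s : Set ℝ, ∫ x in s, (h x - N) * gaussKernel x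
      = (∫ x in s, (h x - h w) * gaussKernel x) + (h w - N) * ∫ x in s, gaussKernel x := by
    intro s
    rw [← integral_const_mul, ← integral_add hk.integrableOn
      (integrable_gaussKernel.const_mul _).integrableOn]
    congr 1 with x
    ring
  have hzero : K₁ + K₂ + (h w - N) * (I + J) = 0 := by
    have h1 := hsplit (Set.Iic w)
    have h2 := hsplit (Set.Ioi w)
    have h3 := intervalIntegral.integral_Iic_add_Ioi (b := w)
      (integrable_lipschitz_sub_mul_gaussKernel hh N).integrableOn
      (integrable_lipschitz_sub_mul_gaussKernel hh N).integrableOn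
    rw [integral_sub_gaussian_mean_mul_gaussKernel hh, h1, h2] at h3
    linarith
  have hK₁b : |K₁| ≤ w * I + p := by
    have hint : Integrable (fun x => w * gaussKernel x - x * gaussKernel x) :=
      (integrable_gaussKernel.const_mul w).sub integrable_id_mul_gaussKernel
    have h1 : ∫ x in Set.Iic w, (w * gaussKernel x - x * gaussKernel x) = w * I + p := by
      rw [integral_sub (integrable_gaussKernel.const_mul w).integrableOn
        integrable_id_mul_gaussKernel.integrableOn, integral_const_mul,
        integral_Iic_id_mul_gaussKernel]
      ring
    rw [← h1, ← Real.norm_eq_abs]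
    refine norm_integral_le_of_norm_le hint.integrableOn ?_
    refine (ae_restrict_iff' measurableSet_Iic).2 (ae_of_all _ fun x hx => ?_)
    have h2 := abs_sub_le_of_lipschitz hh x w
    rw [abs_of_nonpos (a := x - w) (sub_nonpos.2 hx)] at h2
    rw [Real.norm_eq_abs, abs_mul, abs_of_pos (gaussKernel_pos x)]
    nlinarith [gaussKernel_pos x]
  have hK₂b : |K₂| ≤ p - w * J := by
    have hint : Integrable (fun x => x * gaussKernel x - w * gaussKernel x) :=
      integrable_id_mul_gaussKernel.sub (integrable_gaussKernel.const_mul w)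
    have h1 : ∫ x in Set.Ioi w, (x * gaussKernel x - w * gaussKernel x) = p - w * J := by
      rw [integral_sub integrable_id_mul_gaussKernel.integrableOn
        (integrable_gaussKernel.const_mul w).integrableOn, integral_const_mul,
        integral_Ioi_id_mul_gaussKernel]
    rw [← h1, ← Real.norm_eq_abs]
    refine norm_integral_le_of_norm_le hint.integrableOn ?_
    refine (ae_restrict_iff' measurableSet_Ioi).2 (ae_of_all _ fun x hx => ?_)
    have h2 := abs_sub_le_of_lipschitz hh x w
    rw [abs_of_pos (a := x - w) (sub_pos.2 hx)] at h2
    rw [Real.norm_eq_abs, abs_mul, abs_of_pos (gaussKernel_pos x)]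
    nlinarith [gaussKernel_pos x]
  have ha : 0 ≤ (1 + w ^ 2) * J - w * p := sub_nonneg.2 (mul_gaussKernel_le_integral_Ioi w)
  have hb : 0 ≤ (1 + w ^ 2) * I + w * p := by
    have := neg_mul_gaussKernel_le_integral_Iic w
    linarith
  have hT : ((1 + w ^ 2) * steinSol h w + w * (h w - N)) * (p * (I + J))
      = K₁ * ((1 + w ^ 2) * J - w * p) - K₂ * ((1 + w ^ 2) * I + w * p) := by
    have hs : steinSol h w * p = K₁ + (h w - N) * I := by
      rw [steinSol, ← hN, hsplit (Set.Iic w), ← hp, mul_comm,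
        mul_inv_cancel_left₀ hp0.ne']
    have : ((1 + w ^ 2) * steinSol h w + w * (h w - N)) * (p * (I + J))
      = (1 + w ^ 2) * (steinSol h w * p) * (I + J) + w * p * ((h w - N) * (I + J)) := by ring
    rw [this, hs]
    have hd : (h w - N) * (I + J) = -(K₁ + K₂) := by linarith
    linear_combination ((1 + w ^ 2) * I + w * p) * hd
  have hbound : |((1 + w ^ 2) * steinSol h w + w * (h w - N)) * (p * (I + J))|
      ≤ p * (I + J) := by
    rw [hT]
    calc |K₁ * ((1 + w ^ 2) * J - w * p) - K₂ * ((1 + w ^ 2) * I + w * p)|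
        ≤ |K₁| * ((1 + w ^ 2) * J - w * p) + |K₂| * ((1 + w ^ 2) * I + w * p) := by
          refine (abs_sub _ _).trans (le_of_eq ?_)
          rw [abs_mul, abs_mul, abs_of_nonneg ha, abs_of_nonneg hb]
      _ ≤ (w * I + p) * ((1 + w ^ 2) * J - w * p) + (p - w * J) * ((1 + w ^ 2) * I + w * p) := by
          gcongr
      _ = p * (I + J) := by ring
  rw [abs_mul, abs_of_pos (mul_pos hp0 hIJ0)] at hbound
  exact le_of_mul_le_mul_right (by simpa using hbound) (mul_pos hp0 hIJ0)

theorem abs_id_mul_steinSol_sub_le {h : ℝ → ℝ} (hh : LipschitzWith 1 h) (x y : ℝ) :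
    |x * steinSol h x - y * steinSol h y| ≤ |x - y| := by
  have hd : ∀ w, HasDerivAt (fun w => w * steinSol h w)
      ((1 + w ^ 2) * steinSol h w + w * (h w - ∫ z, h z ∂(gaussianReal 0 1))) w := fun w => by
    refine ((hasDerivAt_id w).mul (hasDerivAt_steinSol hh w)).congr_deriv ?_
    simp only [id]
    ring
  have := convex_univ.norm_image_sub_le_of_norm_hasDerivWithin_le (C := 1)
    (fun w _ => (hd w).hasDerivWithinAt) (fun w _ => abs_deriv_id_mul_steinSol_le hh w)
    (Set.mem_univ y) (Set.mem_univ x)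
  simpa using this

theorem abs_steinSol_le {h : ℝ → ℝ} (hh : LipschitzWith 1 h) (w : ℝ) : |steinSol h w| ≤ 1 := by
  have hd := abs_deriv_id_mul_steinSol_le hh 0
  rcases eq_or_ne w 0 with rfl | hw
  · simpa using hd
  · have := abs_id_mul_steinSol_sub_le hh w 0
    simp only [zero_mul, sub_zero, abs_mul] at this
    exact le_of_mul_le_mul_left (by simpa using this) (abs_pos.2 hw)

/-- The derivative of the solution of the Stein equation. -/
noncomputable def steinDeriv (h : ℝ → ℝ) (w : ℝ) : ℝ :=
  w * steinSol h w + (h w - ∫ z, h z ∂(gaussianReal 0 1))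

theorem abs_steinDeriv_sub_le {h : ℝ → ℝ} (hh : LipschitzWith 1 h) (x y : ℝ) :
    |steinDeriv h x - steinDeriv h y| ≤ 2 * |x - y| := by
  have h1 := abs_id_mul_steinSol_sub_le hh x y
  have h2 := abs_sub_le_of_lipschitz hh x y
  have h3 : steinDeriv h x - steinDeriv h y
      = (x * steinSol h x - y * steinSol h y) + (h x - h y) := by
    simp only [steinDeriv]; ring
  rw [h3]
  linarith [abs_add_le (x * steinSol h x - y * steinSol h y) (h x - h y)]

/-- Second-order Taylor bound on a convex set for a function with Lipschitz derivative. -/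
theorem abs_taylor_le_of_lipschitz_deriv {s : Set ℝ} (hs : Convex ℝ s) {g g' : ℝ → ℝ} {C a b : ℝ}
    (hg : ∀ x ∈ s, HasDerivWithinAt g (g' x) s x) (ha : a ∈ s) (hb : b ∈ s)
    (hC : ∀ x ∈ s, |g' x - g' a| ≤ C * |x - a|) :
    |g b - g a - (b - a) * g' a| ≤ C / 2 * (b - a) ^ 2 := by
  have hmem : Set.MapsTo (fun t : ℝ => a + t * (b - a)) (Set.Icc 0 1) s := fun t ht =>
    hs.add_smul_sub_mem ha hb ht
  have hd : ∀ t ∈ Set.Icc (0 : ℝ) 1, HasDerivWithinAt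
      (fun t => g (a + t * (b - a)) - g a - t * ((b - a) * g' a))
      ((b - a) * (g' (a + t * (b - a)) - g' a)) (Set.Icc 0 1) t := by
    intro t ht
    have h1 : HasDerivWithinAt (fun t : ℝ => a + t * (b - a)) (b - a) (Set.Icc 0 1) t := by
      simpa using (((hasDerivAt_id t).mul_const (b - a)).const_add a).hasDerivWithinAt
    have h2 := (hg _ (hmem ht)).comp t h1 hmem
    have h3 : HasDerivWithinAt (fun t : ℝ => t * ((b - a) * g' a)) ((b - a) * g' a)
        (Set.Icc 0 1) t := by
      simpa using ((hasDerivAt_id t).mul_const ((b - a) * g' a)).hasDerivWithinAt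
    exact ((h2.sub_const (g a)).sub h3).congr_deriv (by ring)
  have hB : ∀ t : ℝ, HasDerivAt (fun t : ℝ => C * (b - a) ^ 2 / 2 * t ^ 2)
      (C * (b - a) ^ 2 * t) t := fun t =>
    ((hasDerivAt_pow 2 t).const_mul _).congr_deriv (by norm_num; ring)
  have key := image_norm_le_of_norm_deriv_right_le_deriv_boundary
    (fun t ht => (hd t ht).continuousWithinAt)
    (fun t ht => (hd t ⟨ht.1, ht.2.le⟩).mono_of_mem_nhdsWithin (Icc_mem_nhdsGE_of_mem ht))
    (by simp) hB (fun t ht => ?_) (Set.right_mem_Icc.2 zero_le_one)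
  · simp only [Real.norm_eq_abs, one_mul, add_sub_cancel] at key
    refine key.trans (le_of_eq ?_)
    ring
  · have h1 := hC _ (hmem ⟨ht.1, ht.2.le⟩)
    simp only [add_sub_cancel_left, abs_mul, abs_of_nonneg ht.1] at h1
    rw [Real.norm_eq_abs, abs_mul]
    calc |b - a| * |g' (a + t * (b - a)) - g' a| ≤ |b - a| * (C * (t * |b - a|)) := by gcongr
      _ = C * (b - a) ^ 2 * t := by rw [← sq_abs (b - a)]; ring

/-- Second-order Taylor bound, with the constant that comes from the Lipschitz constant `2` of
the derivative of the solution of the Stein equation. -/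
theorem abs_steinSol_taylor_le {h : ℝ → ℝ} (hh : LipschitzWith 1 h) (w t : ℝ) :
    |steinSol h w - steinSol h (w - t) - t * steinDeriv h w| ≤ t ^ 2 := by
  have := abs_taylor_le_of_lipschitz_deriv convex_univ (a := w) (b := w - t) (C := 2)
    (fun x _ => (hasDerivAt_steinSol hh x).hasDerivWithinAt) (Set.mem_univ _) (Set.mem_univ _)
    (fun x _ => abs_steinDeriv_sub_le hh x w)
  rw [abs_sub_comm] at this
  convert this using 1
  · simp only [steinDeriv]
    ring_nf
  · ring

instance holderTriple_four_four_two : ENNReal.HolderTriple 4 4 2 := ⟨by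
  rw [← ENNReal.toReal_eq_toReal_iff' (by simp) (by simp), ENNReal.toReal_add (by simp) (by simp)]
  norm_num⟩

section

variable {Ω : Type*} [MeasurableSpace Ω] {μ : Measure Ω}

theorem eLpNorm_mul_le {p q r : ℝ≥0∞} [p.HolderTriple q r] {f g : Ω → ℝ}
    (hf : AEStronglyMeasurable f μ) (hg : AEStronglyMeasurable g μ) :
    eLpNorm (f * g) r μ ≤ eLpNorm f p μ * eLpNorm g q μ := by
  simpa [smul_eq_mul] using eLpNorm_smul_le_mul_eLpNorm (p := p) (q := q) (r := r) hg hf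

theorem continuous_steinSol {h : ℝ → ℝ} (hh : LipschitzWith 1 h) : Continuous (steinSol h) :=
  continuous_iff_continuousAt.2 fun w => (hasDerivAt_steinSol hh w).continuousAt

theorem continuous_steinDeriv {h : ℝ → ℝ} (hh : LipschitzWith 1 h) : Continuous (steinDeriv h) :=
  (continuous_id.mul (continuous_steinSol hh)).add (hh.continuous.sub continuous_const)

theorem integrable_mul_steinSol_comp {h : ℝ → ℝ} (hh : LipschitzWith 1 h) {x W : Ω → ℝ}
    (hx : Integrable x μ) (hW : AEStronglyMeasurable W μ) :
    Integrable (fun ω => x ω * steinSol h (W ω)) μ :=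
  hx.mul_bdd (c := 1) ((continuous_steinSol hh).comp_aestronglyMeasurable hW)
    (ae_of_all _ fun ω => abs_steinSol_le hh (W ω))

variable [IsProbabilityMeasure μ]

theorem memLp_steinDeriv_comp {h : ℝ → ℝ} (hh : LipschitzWith 1 h) {W : Ω → ℝ} {p : ℝ≥0∞}
    (hW : MemLp W p μ) : MemLp (fun ω => steinDeriv h (W ω)) p μ := by
  have hb : MemLp (fun ω => 2 * |W ω| + |steinDeriv h 0|) p μ :=
    (hW.abs.const_mul 2).add (memLp_const _)
  refine hb.mono ((continuous_steinDeriv hh).comp_aestronglyMeasurable hW.1)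
    (ae_of_all _ fun ω => ?_)
  have h1 := abs_steinDeriv_sub_le hh (W ω) 0
  have h2 := abs_sub_abs_le_abs_sub (steinDeriv h (W ω)) (steinDeriv h 0)
  simp only [sub_zero] at h1
  rw [Real.norm_eq_abs, Real.norm_eq_abs, abs_of_nonneg (by positivity : 0 ≤ 2 * |W ω| + _)]
  linarith

/-- One summand of Stein's method under local dependence: `x` is the summand, `y` the sum over
its dependency neighbourhood, `t` the sum over the dependency neighbourhood of `x y`. -/
theorem enorm_stein_local_le {h : ℝ → ℝ} (hh : LipschitzWith 1 h) {x y t W : Ω → ℝ}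
    (hx : MemLp x 4 μ) (hy : MemLp y 4 μ) (ht : MemLp t 4 μ) (hW : MemLp W 4 μ)
    (hx0 : ∫ ω, x ω ∂μ = 0) (hind : IndepFun x (W - y) μ) (hind' : IndepFun (x * y) (W - t) μ) :
    ‖(∫ ω, x ω * y ω ∂μ) * (∫ ω, steinDeriv h (W ω) ∂μ) - ∫ ω, x ω * steinSol h (W ω) ∂μ‖ₑ
      ≤ 2 * (eLpNorm (x * y * t) 1 μ + eLpNorm (x * y) 1 μ * eLpNorm t 1 μ)
        + eLpNorm (x * (y * y)) 1 μ := by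
  have hxi : Integrable x μ := hx.integrable (by norm_num)
  have hxy : MemLp (x * y) 2 μ := hy.mul hx
  have hD : MemLp (fun ω => steinDeriv h (W ω)) 4 μ := memLp_steinDeriv_comp hh hW
  have hD' : MemLp (fun ω => steinDeriv h ((W - t) ω)) 4 μ := memLp_steinDeriv_comp hh (hW.sub ht)
  have hxyD : Integrable (fun ω => (x * y) ω * steinDeriv h (W ω)) μ :=
    hxy.integrable_mul (hD.mono_exponent (p := 2) (by norm_num))
  have hxyD' : Integrable (fun ω => (x * y) ω * steinDeriv h ((W - t) ω)) μ :=
    hxy.integrable_mul (hD'.mono_exponent (p := 2) (by norm_num))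
  have hDi : Integrable (fun ω => steinDeriv h (W ω)) μ := hD.integrable (by norm_num)
  have hDi' : Integrable (fun ω => steinDeriv h ((W - t) ω)) μ := hD'.integrable (by norm_num)
  have hf : Integrable (fun ω => x ω * steinSol h (W ω)) μ :=
    integrable_mul_steinSol_comp hh hxi hW.1
  have hf' : Integrable (fun ω => x ω * steinSol h ((W - y) ω)) μ :=
    integrable_mul_steinSol_comp hh hxi (hW.sub hy).1
  have e1 : ∫ ω, x ω * steinSol h ((W - y) ω) ∂μ = 0 := by
    have := hind.integral_fun_comp_mul_comp (f := id) (g := steinSol h) hx.1.aemeasurable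
      (hW.sub hy).1.aemeasurable aestronglyMeasurable_id
      (continuous_steinSol hh).aestronglyMeasurable
    simpa [hx0] using this
  have e2 : ∫ ω, (x * y) ω * steinDeriv h ((W - t) ω) ∂μ
      = (∫ ω, x ω * y ω ∂μ) * ∫ ω, steinDeriv h ((W - t) ω) ∂μ :=
    hind'.integral_fun_comp_mul_comp (f := id) (g := steinDeriv h) hxy.1.aemeasurable
      (hW.sub ht).1.aemeasurable aestronglyMeasurable_id
      (continuous_steinDeriv hh).aestronglyMeasurable
  have hdecomp : (∫ ω, x ω * y ω ∂μ) * (∫ ω, steinDeriv h (W ω) ∂μ)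
        - ∫ ω, x ω * steinSol h (W ω) ∂μ
      = (∫ ω, x ω * y ω ∂μ) * (∫ ω, (steinDeriv h (W ω) - steinDeriv h ((W - t) ω)) ∂μ)
        - (∫ ω, (x * y) ω * (steinDeriv h (W ω) - steinDeriv h ((W - t) ω)) ∂μ)
        - ∫ ω, x ω * (steinSol h (W ω) - steinSol h ((W - y) ω) - y ω * steinDeriv h (W ω)) ∂μ := by
    have a1 : ∫ ω, (x * y) ω * (steinDeriv h (W ω) - steinDeriv h ((W - t) ω)) ∂μ
        = (∫ ω, (x * y) ω * steinDeriv h (W ω) ∂μ)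
          - ∫ ω, (x * y) ω * steinDeriv h ((W - t) ω) ∂μ := by
      rw [← integral_sub hxyD hxyD']
      simp only [mul_sub]
    have a2 : ∫ ω, x ω * (steinSol h (W ω) - steinSol h ((W - y) ω)
          - y ω * steinDeriv h (W ω)) ∂μ
        = (∫ ω, x ω * steinSol h (W ω) ∂μ) - (∫ ω, x ω * steinSol h ((W - y) ω) ∂μ)
          - ∫ ω, (x * y) ω * steinDeriv h (W ω) ∂μ := by
      have hff : Integrable (fun ω => x ω * steinSol h (W ω) - x ω * steinSol h ((W - y) ω)) μ :=
        hf.sub hf'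
      rw [← integral_sub hf hf', ← integral_sub hff hxyD]
      simp only [mul_sub, Pi.mul_apply, mul_assoc]
    rw [integral_sub hDi hDi', a1, a2, e1, e2]
    ring
  have hL : ∀ ω, ‖steinDeriv h (W ω) - steinDeriv h ((W - t) ω)‖ₑ ≤ 2 * ‖t ω‖ₑ := by
    intro ω
    have := abs_steinDeriv_sub_le hh (W ω) ((W - t) ω)
    simp only [Pi.sub_apply, sub_sub_cancel] at this
    rw [Real.enorm_eq_ofReal_abs, Real.enorm_eq_ofReal_abs, ← ENNReal.ofReal_ofNat 2,
      ← ENNReal.ofReal_mul (by norm_num)]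
    exact ENNReal.ofReal_le_ofReal this
  have b1 : ‖∫ ω, (steinDeriv h (W ω) - steinDeriv h ((W - t) ω)) ∂μ‖ₑ ≤ 2 * eLpNorm t 1 μ := by
    refine (enorm_integral_le_lintegral_enorm _).trans ((lintegral_mono hL).trans ?_)
    rw [lintegral_const_mul' _ _ (by norm_num), eLpNorm_one_eq_lintegral_enorm]
  have b2 : ‖∫ ω, (x * y) ω * (steinDeriv h (W ω) - steinDeriv h ((W - t) ω)) ∂μ‖ₑ
      ≤ 2 * eLpNorm (x * y * t) 1 μ := by
    refine (enorm_integral_le_lintegral_enorm _).trans ?_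
    rw [eLpNorm_one_eq_lintegral_enorm, ← lintegral_const_mul' _ _ (by norm_num)]
    refine lintegral_mono fun ω => ?_
    simp only [Pi.mul_apply, enorm_mul]
    calc _ ≤ ‖x ω‖ₑ * ‖y ω‖ₑ * (2 * ‖t ω‖ₑ) := by gcongr; exact hL ω
      _ = _ := by ring
  have b3 : ‖∫ ω, x ω * (steinSol h (W ω) - steinSol h ((W - y) ω)
      - y ω * steinDeriv h (W ω)) ∂μ‖ₑ ≤ eLpNorm (x * (y * y)) 1 μ := by
    refine (enorm_integral_le_lintegral_enorm _).trans ?_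
    rw [eLpNorm_one_eq_lintegral_enorm]
    refine lintegral_mono fun ω => ?_
    simp only [Pi.mul_apply, Pi.sub_apply, enorm_mul (x ω)]
    gcongr
    rw [Real.enorm_eq_ofReal_abs, Real.enorm_eq_ofReal_abs, abs_mul_self, ← sq]
    exact ENNReal.ofReal_le_ofReal (abs_steinSol_taylor_le hh (W ω) (y ω))
  have b4 : ‖∫ ω, x ω * y ω ∂μ‖ₑ ≤ eLpNorm (x * y) 1 μ := by
    rw [eLpNorm_one_eq_lintegral_enorm]
    exact enorm_integral_le_lintegral_enorm _
  rw [hdecomp]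
  calc _ ≤ ‖∫ ω, x ω * y ω ∂μ‖ₑ
            * ‖∫ ω, (steinDeriv h (W ω) - steinDeriv h ((W - t) ω)) ∂μ‖ₑ
          + ‖∫ ω, (x * y) ω * (steinDeriv h (W ω) - steinDeriv h ((W - t) ω)) ∂μ‖ₑ
          + ‖∫ ω, x ω * (steinSol h (W ω) - steinSol h ((W - y) ω)
            - y ω * steinDeriv h (W ω)) ∂μ‖ₑ := by
        refine enorm_sub_le.trans ?_
        gcongr
        refine enorm_sub_le.trans ?_
        rw [enorm_mul]
    _ ≤ eLpNorm (x * y) 1 μ * (2 * eLpNorm t 1 μ) + 2 * eLpNorm (x * y * t) 1 μ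
          + eLpNorm (x * (y * y)) 1 μ := by gcongr
    _ = _ := by ring

theorem sum_mul_sum_le_card_mul_sum {ι : Type*} (s : Finset ι) {a : ι → ℝ≥0∞} (ha : ∀ i ∈ s, a i ≠ ∞) :
    (∑ i ∈ s, a i) * (∑ i ∈ s, a i) ≤ s.card * ∑ i ∈ s, a i * a i := by
  have h : ∀ i ∈ s, a i = ((a i).toNNReal : ℝ≥0∞) := fun i hi => (ENNReal.coe_toNNReal (ha i hi)).symm
  have h' : ∀ i ∈ s, a i * a i = ((a i).toNNReal * (a i).toNNReal : ℝ≥0∞) := fun i hi => by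
    rw [← h i hi]
  rw [Finset.sum_congr rfl h, Finset.sum_congr rfl h']
  have := sq_sum_le_card_mul_sum_sq (s := s) (f := fun i => (a i).toNNReal)
  simp only [sq] at this
  exact_mod_cast this

/-- Normal approximation of a sum of locally dependent random variables with finite fourth
moments, in terms of `L²` and `L⁴` norms. -/
theorem enorm_integral_sub_gaussian_le_of_local_dependence {ι : Type*} (s : Finset ι)
    (A B : ι → Finset ι) (hA : ∀ i ∈ s, A i ⊆ s) (hB : ∀ i ∈ s, B i ⊆ s) {ξ : ι → Ω → ℝ}
    (hξ : ∀ i ∈ s, MemLp (ξ i) 4 μ) (hξ0 : ∀ i ∈ s, ∫ ω, ξ i ω ∂μ = 0)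
    (hvar : ∫ ω, (∑ i ∈ s, ξ i ω) ^ 2 ∂μ = 1)
    (hindA : ∀ i ∈ s, IndepFun (ξ i) (∑ j ∈ s, ξ j - ∑ j ∈ A i, ξ j) μ)
    (hindB : ∀ i ∈ s, IndepFun (ξ i * ∑ j ∈ A i, ξ j) (∑ j ∈ s, ξ j - ∑ j ∈ B i, ξ j) μ)
    {h : ℝ → ℝ} (hh : LipschitzWith 1 h) :
    ‖(∫ ω, h (∑ i ∈ s, ξ i ω) ∂μ) - ∫ z, h z ∂(gaussianReal 0 1)‖ₑ
      ≤ 2 * (∑ i ∈ s, ∑ j ∈ A i, ∑ k ∈ B i,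
            eLpNorm (ξ i) 4 μ * eLpNorm (ξ j) 4 μ * eLpNorm (ξ k) 4 μ)
        + 2 * (∑ i ∈ s, ∑ j ∈ A i, ∑ k ∈ B i,
            eLpNorm (ξ i) 2 μ * eLpNorm (ξ j) 2 μ * eLpNorm (ξ k) 2 μ)
        + ∑ i ∈ s, (A i).card * ∑ j ∈ A i,
            eLpNorm (ξ i) 2 μ * (eLpNorm (ξ j) 4 μ * eLpNorm (ξ j) 4 μ) := by
  set W : Ω → ℝ := ∑ i ∈ s, ξ i with hWdef
  have hWap : ∀ ω, W ω = ∑ i ∈ s, ξ i ω := fun ω => by rw [hWdef, Finset.sum_apply]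
  have hsum : ∀ u ⊆ s, MemLp (∑ i ∈ u, ξ i) 4 μ := fun u hu =>
    memLp_finsetSum' u fun i hi => hξ i (hu hi)
  have hW : MemLp W 4 μ := hsum s subset_rfl
  have hη : ∀ i ∈ s, MemLp (∑ j ∈ A i, ξ j) 4 μ := fun i hi => hsum _ (hA i hi)
  have hτ : ∀ i ∈ s, MemLp (∑ j ∈ B i, ξ j) 4 μ := fun i hi => hsum _ (hB i hi)
  have hprod : ∀ {u v : Ω → ℝ}, MemLp u 4 μ → MemLp v 4 μ → Integrable (fun ω => u ω * v ω) μ :=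
    fun hu hv => MemLp.integrable_mul (hu.mono_exponent (p := 2) (by norm_num))
      (hv.mono_exponent (p := 2) (by norm_num))
  have hone : ∑ i ∈ s, ∫ ω, ξ i ω * (∑ j ∈ A i, ξ j) ω ∂μ = 1 := by
    rw [← hvar]
    have h1 : ∀ i ∈ s, ∫ ω, ξ i ω * (∑ j ∈ A i, ξ j) ω ∂μ = ∫ ω, ξ i ω * W ω ∂μ := by
      intro i hi
      have h2 := (hindA i hi).integral_fun_mul_eq_mul_integral (hξ i hi).1 (hW.sub (hη i hi)).1
      rw [hξ0 i hi, zero_mul] at h2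
      have h3 : ∫ ω, ξ i ω * (W - ∑ j ∈ A i, ξ j) ω ∂μ
          = (∫ ω, ξ i ω * W ω ∂μ) - ∫ ω, ξ i ω * (∑ j ∈ A i, ξ j) ω ∂μ := by
        rw [← integral_sub (hprod (hξ i hi) hW) (hprod (hξ i hi) (hη i hi))]
        simp only [Pi.sub_apply, mul_sub]
      linarith
    rw [Finset.sum_congr rfl h1, ← integral_finsetSum _ fun i hi => hprod (hξ i hi) hW]
    congr 1 with ω
    rw [← Finset.sum_mul, ← hWap, sq]
  have hDi : Integrable (fun ω => steinDeriv h (W ω)) μ :=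
    (memLp_steinDeriv_comp hh hW).integrable (by norm_num)
  have hfi : ∀ i ∈ s, Integrable (fun ω => ξ i ω * steinSol h (W ω)) μ := fun i hi =>
    integrable_mul_steinSol_comp hh ((hξ i hi).integrable (by norm_num)) hW.1
  have hstein : (∫ ω, h (∑ i ∈ s, ξ i ω) ∂μ) - ∫ z, h z ∂(gaussianReal 0 1)
      = ∑ i ∈ s, ((∫ ω, ξ i ω * (∑ j ∈ A i, ξ j) ω ∂μ) * (∫ ω, steinDeriv h (W ω) ∂μ)
        - ∫ ω, ξ i ω * steinSol h (W ω) ∂μ) := by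
    rw [Finset.sum_sub_distrib, ← Finset.sum_mul, hone, one_mul, ← integral_finsetSum _ hfi,
      ← integral_sub hDi (integrable_finsetSum _ hfi)]
    have h1 : ∀ ω, h (∑ i ∈ s, ξ i ω)
        = (steinDeriv h (W ω) - ∑ i ∈ s, ξ i ω * steinSol h (W ω))
          + ∫ z, h z ∂(gaussianReal 0 1) := fun ω => by
      rw [← Finset.sum_mul, ← hWap, steinDeriv]
      ring
    simp only [h1]
    have h2 : Integrable (fun ω => steinDeriv h (W ω) - ∑ i ∈ s, ξ i ω * steinSol h (W ω)) μ :=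
      hDi.sub (integrable_finsetSum _ hfi)
    rw [integral_add h2 (integrable_const _)]
    simp
  rw [hstein]
  refine (enorm_sum_le _ _).trans ?_
  rw [Finset.mul_sum, Finset.mul_sum, ← Finset.sum_add_distrib, ← Finset.sum_add_distrib]
  refine Finset.sum_le_sum fun i hi => ?_
  refine (enorm_stein_local_le hh (hξ i hi) (hη i hi) (hτ i hi) hW (hξ0 i hi) (hindA i hi)
    (hindB i hi)).trans ?_
  have hηsum : ∀ p : ℝ≥0∞, 1 ≤ p → eLpNorm (∑ j ∈ A i, ξ j) p μ ≤ ∑ j ∈ A i, eLpNorm (ξ j) p μ :=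
    fun p hp => eLpNorm_sum_le (fun j hj => (hξ j (hA i hi hj)).1) hp
  have hτsum : ∀ p : ℝ≥0∞, 1 ≤ p → eLpNorm (∑ j ∈ B i, ξ j) p μ ≤ ∑ j ∈ B i, eLpNorm (ξ j) p μ :=
    fun p hp => eLpNorm_sum_le (fun j hj => (hξ j (hB i hi hj)).1) hp
  have hxm := (hξ i hi).1
  have hym := (hη i hi).1
  have htm := (hτ i hi).1
  have t1 : eLpNorm (ξ i * (∑ j ∈ A i, ξ j) * ∑ k ∈ B i, ξ k) 1 μ
      ≤ ∑ j ∈ A i, ∑ k ∈ B i, eLpNorm (ξ i) 4 μ * eLpNorm (ξ j) 4 μ * eLpNorm (ξ k) 4 μ := by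
    calc _ ≤ eLpNorm (ξ i * ∑ j ∈ A i, ξ j) 2 μ * eLpNorm (∑ k ∈ B i, ξ k) 2 μ :=
          eLpNorm_mul_le (hxm.mul hym) htm
      _ ≤ (eLpNorm (ξ i) 4 μ * eLpNorm (∑ j ∈ A i, ξ j) 4 μ) * eLpNorm (∑ k ∈ B i, ξ k) 4 μ := by
          gcongr
          · exact eLpNorm_mul_le hxm hym
          · exact eLpNorm_le_eLpNorm_of_exponent_le (by norm_num) htm
      _ ≤ (eLpNorm (ξ i) 4 μ * ∑ j ∈ A i, eLpNorm (ξ j) 4 μ) * ∑ k ∈ B i, eLpNorm (ξ k) 4 μ := by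
          gcongr
          · exact hηsum 4 (by norm_num)
          · exact hτsum 4 (by norm_num)
      _ = _ := by simp only [Finset.mul_sum, Finset.sum_mul]; rw [Finset.sum_comm]
  have t2 : eLpNorm (ξ i * ∑ j ∈ A i, ξ j) 1 μ * eLpNorm (∑ k ∈ B i, ξ k) 1 μ
      ≤ ∑ j ∈ A i, ∑ k ∈ B i, eLpNorm (ξ i) 2 μ * eLpNorm (ξ j) 2 μ * eLpNorm (ξ k) 2 μ := by
    calc _ ≤ (eLpNorm (ξ i) 2 μ * eLpNorm (∑ j ∈ A i, ξ j) 2 μ) * eLpNorm (∑ k ∈ B i, ξ k) 2 μ := by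
          gcongr
          · exact eLpNorm_mul_le hxm hym
          · exact eLpNorm_le_eLpNorm_of_exponent_le (by norm_num) htm
      _ ≤ (eLpNorm (ξ i) 2 μ * ∑ j ∈ A i, eLpNorm (ξ j) 2 μ) * ∑ k ∈ B i, eLpNorm (ξ k) 2 μ := by
          gcongr
          · exact hηsum 2 (by norm_num)
          · exact hτsum 2 (by norm_num)
      _ = _ := by simp only [Finset.mul_sum, Finset.sum_mul]; rw [Finset.sum_comm]
  have t3 : eLpNorm (ξ i * ((∑ j ∈ A i, ξ j) * ∑ j ∈ A i, ξ j)) 1 μ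
      ≤ (A i).card * ∑ j ∈ A i,
            eLpNorm (ξ i) 2 μ * (eLpNorm (ξ j) 4 μ * eLpNorm (ξ j) 4 μ) := by
    calc _ ≤ eLpNorm (ξ i) 2 μ * eLpNorm ((∑ j ∈ A i, ξ j) * ∑ j ∈ A i, ξ j) 2 μ :=
          eLpNorm_mul_le hxm (hym.mul hym)
      _ ≤ eLpNorm (ξ i) 2 μ * (eLpNorm (∑ j ∈ A i, ξ j) 4 μ * eLpNorm (∑ j ∈ A i, ξ j) 4 μ) := by
          gcongr
          exact eLpNorm_mul_le hym hym
      _ ≤ eLpNorm (ξ i) 2 μ * ((∑ j ∈ A i, eLpNorm (ξ j) 4 μ) * ∑ j ∈ A i, eLpNorm (ξ j) 4 μ) := by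
          gcongr <;> exact hηsum 4 (by norm_num)
      _ ≤ eLpNorm (ξ i) 2 μ * ((A i).card * ∑ j ∈ A i, eLpNorm (ξ j) 4 μ * eLpNorm (ξ j) 4 μ) := by
          gcongr eLpNorm (ξ i) 2 μ * ?_
          exact sum_mul_sum_le_card_mul_sum _ fun j hj => (hξ j (hA i hi hj)).2.ne
      _ = _ := by rw [← Finset.mul_sum]; ring
  rw [← mul_add]
  gcongr 2 * (?_ + ?_) + ?_

end

section

variable {Ω : Type*}

/-- The σ-algebra generated by the variables `X j`, `j ∈ s`. -/
abbrev sigmaOf (X : ℕ → Ω → ℝ) (s : Set ℕ) : MeasurableSpace Ω :=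
  ⨆ j ∈ s, MeasurableSpace.comap (X j) inferInstance

theorem sigmaOf_mono (X : ℕ → Ω → ℝ) {s t : Set ℕ} (h : s ⊆ t) : sigmaOf X s ≤ sigmaOf X t :=
  biSup_mono h

theorem sigmaOf_union (X : ℕ → Ω → ℝ) (s t : Set ℕ) :
    sigmaOf X (s ∪ t) = sigmaOf X s ⊔ sigmaOf X t := iSup_union

theorem measurable_sigmaOf (X : ℕ → Ω → ℝ) {s : Set ℕ} {j : ℕ} (hj : j ∈ s) :
    Measurable[sigmaOf X s] (X j) :=
  (comap_measurable (X j)).mono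
    (le_iSup₂_of_le (f := fun j (_ : j ∈ s) => MeasurableSpace.comap (X j) inferInstance)
      j hj le_rfl) le_rfl

theorem sigmaOf_le_comap (X : ℕ → Ω → ℝ) {s t : Set ℕ} (h : s ⊆ t) :
    sigmaOf X s ≤ MeasurableSpace.comap (fun ω (j : t) => X j ω) inferInstance := by
  refine iSup₂_le fun j hj => ?_
  have : X j = (fun x : t → ℝ => x ⟨j, h hj⟩) ∘ fun ω (j : t) => X j ω := rfl
  rw [this, ← MeasurableSpace.comap_comp]
  exact MeasurableSpace.comap_mono (measurable_pi_apply _).comap_le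

end

section

variable {Ω : Type*} [mΩ : MeasurableSpace Ω] {μ : Measure Ω}

theorem indep_sup_of_indep_sup [IsProbabilityMeasure μ] {m₁ m₂ m₃ : MeasurableSpace Ω}
    (h₁ : m₁ ≤ mΩ) (h₂ : m₂ ≤ mΩ) (h₃ : m₃ ≤ mΩ)
    (hi : Indep m₁ (m₂ ⊔ m₃) μ) (hi' : Indep m₂ m₃ μ) : Indep m₂ (m₁ ⊔ m₃) μ := by
  set π : Set (Set Ω) := {s | ∃ a c, MeasurableSet[m₁] a ∧ MeasurableSet[m₃] c ∧ s = a ∩ c} with hπ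
  have hpi : IsPiSystem π := by
    rintro _ ⟨a, c, ha, hc, rfl⟩ _ ⟨a', c', ha', hc', rfl⟩ -
    exact ⟨a ∩ a', c ∩ c', ha.inter ha', hc.inter hc', by
      rw [Set.inter_inter_inter_comm]⟩
  have hgen : m₁ ⊔ m₃ = MeasurableSpace.generateFrom π := by
    apply le_antisymm
    · refine sup_le (fun a ha => ?_) fun c hc => ?_
      · exact MeasurableSpace.measurableSet_generateFrom ⟨a, Set.univ, ha, MeasurableSet.univ, by simp⟩
      · exact MeasurableSpace.measurableSet_generateFrom ⟨Set.univ, c, MeasurableSet.univ, hc, by simp⟩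
    · refine MeasurableSpace.generateFrom_le ?_
      rintro _ ⟨a, c, ha, hc, rfl⟩
      exact (le_sup_left (a := m₁) _ ha).inter (le_sup_right (a := m₁) _ hc)
  refine IndepSets.indep h₂ (sup_le h₁ h₃) (@MeasurableSpace.isPiSystem_measurableSet _ m₂) hpi
    (@MeasurableSpace.generateFrom_measurableSet _ m₂).symm hgen ?_
  rw [IndepSets_iff]
  rintro b _ hb ⟨a, c, ha, hc, rfl⟩
  have hb' : MeasurableSet[m₂] b := hb
  have hbc : MeasurableSet[m₂ ⊔ m₃] (b ∩ c) :=
    (le_sup_left (a := m₂) _ hb').inter (le_sup_right (a := m₂) _ hc)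
  have e1 := (Indep_iff _ _ _).1 hi a (b ∩ c) ha hbc
  have e2 := (Indep_iff _ _ _).1 hi' b c hb' hc
  have e3 := (Indep_iff _ _ _).1 hi a c ha (le_sup_right (a := m₂) _ hc)
  rw [e3, Set.inter_left_comm, e1, e2]
  ring

theorem sigmaOf_le {X : ℕ → Ω → ℝ} (hX : ∀ i, Measurable (X i)) (s : Set ℕ) :
    sigmaOf X s ≤ mΩ := iSup₂_le fun j _ => (hX j).comap_le

variable [IsProbabilityMeasure μ] {X : ℕ → Ω → ℝ} {m : ℕ}

theorem IsMDependent.indep_sigmaOf (hdep : IsMDependent X m μ) {s t : Set ℕ}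
    (hs : ∀ a ∈ s, 1 ≤ a) (hst : ∀ a ∈ s, ∀ b ∈ t, a + m < b) :
    Indep (sigmaOf X s) (sigmaOf X t) μ := by
  rcases t.eq_empty_or_nonempty with rfl | ⟨b, hb⟩
  · have : sigmaOf X ∅ = ⊥ := by simp [sigmaOf]
    rw [this]
    exact indep_bot_right _
  rcases s.eq_empty_or_nonempty with rfl | hne
  · have : sigmaOf X ∅ = ⊥ := by simp [sigmaOf]
    rw [this]
    exact indep_bot_left _
  have hbdd : BddAbove s := ⟨b, fun a ha => by have := hst a ha b hb; omega⟩
  refine indep_of_indep_of_le (hdep (sSup s)) (sigmaOf_le_comap X fun a ha => ?_)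
    (sigmaOf_le_comap X fun b hb => ?_)
  · exact ⟨hs a ha, le_csSup hbdd ha⟩
  · exact hst _ (Nat.sSup_mem hne hbdd) b hb

theorem IsMDependent.indep_sigmaOf_two_sided (hX : ∀ i, Measurable (X i))
    (hdep : IsMDependent X m μ) {s t u : Set ℕ} (hs : ∀ a ∈ s, 1 ≤ a) (ht : ∀ a ∈ t, 1 ≤ a)
    (hst : ∀ a ∈ s, ∀ b ∈ t, a + m < b) (hsu : ∀ a ∈ s, ∀ b ∈ u, a + m < b)
    (htu : ∀ a ∈ t, ∀ b ∈ u, a + m < b) :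
    Indep (sigmaOf X t) (sigmaOf X (s ∪ u)) μ := by
  rw [sigmaOf_union]
  refine indep_sup_of_indep_sup (sigmaOf_le hX _) (sigmaOf_le hX _) (sigmaOf_le hX _) ?_
    (hdep.indep_sigmaOf ht htu)
  rw [← sigmaOf_union]
  exact hdep.indep_sigmaOf hs fun a ha b hb => hb.elim (hst a ha b) (hsu a ha b)

/-- The indices on which the `i`-th score term depends. -/
def window (m i : ℕ) : Set ℕ := Set.Icc (max (i - m) 1) i

/-- A function of the windows within distance `r` of `i` is independent of the sum of the terms
whose index is at distance more than `r + 2 m` from `i`. -/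
theorem IsMDependent.indepFun_sum_sub_sum_nbhd (hX : ∀ i, Measurable (X i))
    (hdep : IsMDependent X m μ) {n r i : ℕ} {ζ : ℕ → Ω → ℝ} {U : Ω → ℝ}
    (hζ : ∀ j ∈ Finset.Icc 1 n, Measurable[sigmaOf X (window m j)] (ζ j))
    (hU : Measurable[sigmaOf X {a | 1 ≤ a ∧ i ≤ a + r + m ∧ a ≤ i + r}] U) :
    IndepFun U (∑ j ∈ Finset.Icc 1 n, ζ j - ∑ j ∈ nbhd n (r + 2 * m) i, ζ j) μ := by
  have hsub : nbhd n (r + 2 * m) i ⊆ Finset.Icc 1 n := by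
    intro j hj
    simp only [nbhd, Finset.mem_Icc] at hj ⊢
    omega
  have hind := hdep.indep_sigmaOf_two_sided hX (s := {a | 1 ≤ a ∧ a + r + 2 * m < i})
    (t := {a | 1 ≤ a ∧ i ≤ a + r + m ∧ a ≤ i + r}) (u := {b | i + r + m < b})
    (fun a ha => ha.1) (fun a ha => ha.1)
    (fun a ha b hb => by simp only [Set.mem_ofPred_eq] at ha hb; omega)
    (fun a ha b hb => by simp only [Set.mem_ofPred_eq] at ha hb; omega)
    (fun a ha b hb => by simp only [Set.mem_ofPred_eq] at ha hb; omega)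
  refine indep_of_indep_of_le hind hU.comap_le (Measurable.comap_le ?_)
  rw [← Finset.sum_sdiff hsub, add_sub_cancel_right]
  rw [Finset.sum_fn]
  refine Finset.measurable_sum (M := ℝ) _ fun j hj => ?_
  rw [Finset.mem_sdiff] at hj
  refine (hζ j hj.1).mono (sigmaOf_mono X fun a ha => ?_) le_rfl
  obtain ⟨h1, h2⟩ := hj
  simp only [nbhd, Finset.mem_Icc, window, Set.mem_Icc, Set.mem_union, Set.mem_ofPred_eq] at h1 h2 ha ⊢
  omega

end

theorem measurable_sigmaOf_condTerm {Ω : Type*} {m : ℕ} {f : CondDensities m} {X : ℕ → Ω → ℝ}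
    {i : ℕ} {θ : ℝ} (hi : 1 ≤ i)
    (hf : Measurable (Function.uncurry (f i θ))) :
    Measurable[sigmaOf X (window m i)] (fun ω => condTerm f i θ fun j => X j ω) := by
  have h1 : Measurable[sigmaOf X (window m i)]
      fun ω => ((past m i).restrict (fun j => X j ω), X i ω) := by
    refine Measurable.prodMk (@measurable_pi_lambda _ _ _ (sigmaOf X (window m i)) _ _ fun j => ?_) ?_
    · refine measurable_sigmaOf X ?_
      have := j.2
      simp only [past, Finset.mem_Ico] at this
      exact ⟨this.1, this.2.le⟩
    · refine measurable_sigmaOf X ?_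
      simp only [window, Set.mem_Icc]
      omega
  exact hf.comp h1

section

variable {Ω : Type*} [mΩ : MeasurableSpace Ω] {μ : Measure Ω}

/-- A derivative in a parameter inherits measurability, up to almost sure equality, with respect
to a sub-σ-algebra. -/
theorem exists_measurable_ae_eq_derivWithin {𝓖 : MeasurableSpace Ω} {Θ : Set ℝ} {θ₀ : ℝ}
    (hθ₀ : θ₀ ∈ Θ) (hΘ : UniqueDiffWithinAt ℝ Θ θ₀) {F : ℝ → Ω → ℝ}
    (hF : ∀ θ ∈ Θ, ∃ g : Ω → ℝ, Measurable[𝓖] g ∧ F θ =ᵐ[μ] g)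
    (hd : ∀ᵐ ω ∂μ, DifferentiableWithinAt ℝ (fun θ => F θ ω) Θ θ₀) :
    ∃ g : Ω → ℝ, Measurable[𝓖] g ∧ (fun ω => derivWithin (fun θ => F θ ω) Θ θ₀) =ᵐ[μ] g := by
  have hacc : AccPt θ₀ (𝓟 Θ) := hΘ.accPt
  rw [accPt_principal_iff_nhdsWithin] at hacc
  obtain ⟨u, hu⟩ := exists_seq_tendsto (𝓝[Θ \ {θ₀}] θ₀)
  have humem : ∀ᶠ k in atTop, u k ∈ Θ \ {θ₀} := hu.eventually self_mem_nhdsWithin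
  obtain ⟨K, hK⟩ := eventually_atTop.1 humem
  set v : ℕ → ℝ := fun k => u (k + K) with hv
  have hvmem : ∀ k, v k ∈ Θ \ {θ₀} := fun k => hK _ (Nat.le_add_left _ _)
  have hvt : Tendsto v atTop (𝓝[Θ \ {θ₀}] θ₀) := hu.comp (tendsto_add_atTop_nat K)
  choose g hg hFg using hF
  set D : ℕ → Ω → ℝ := fun k ω => (v k - θ₀)⁻¹ * (g (v k) (hvmem k).1 ω - g θ₀ hθ₀ ω) with hD
  have hDm : ∀ k, Measurable[𝓖] (D k) := fun k =>
    ((hg _ _).sub (hg _ _)).const_mul _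
  refine ⟨fun ω => limsup (fun k => D k ω) atTop, Measurable.limsup hDm, ?_⟩
  have hae : ∀ᵐ ω ∂μ, ∀ k, F (v k) ω = g (v k) (hvmem k).1 ω :=
    ae_all_iff.2 fun k => hFg _ _
  filter_upwards [hae, hFg θ₀ hθ₀, hd] with ω h1 h2 h3
  have h4 := (hasDerivWithinAt_iff_tendsto_slope.1 h3.hasDerivWithinAt).comp hvt
  refine (Tendsto.limsup_eq (h4.congr fun k => ?_)).symm
  simp only [Function.comp_apply, slope_def_field, hD, ← h1, ← h2]
  rw [div_eq_inv_mul]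

/-- A conditional density is almost surely positive along the sample. -/
theorem IsCondDensity.ae_pos {E : Type*} [MeasurableSpace E] {ν : Measure ℝ} {Y : Ω → E}
    {X : Ω → ℝ} {g : E → ℝ → ℝ} (h : IsCondDensity μ ν Y X g) (hY : Measurable Y)
    (hX : Measurable X) : ∀ᵐ ω ∂μ, 0 < g (Y ω) (X ω) := by
  have hs : MeasurableSet {p : E × ℝ | ¬ 0 < g p.1 p.2} :=
    (measurableSet_lt measurable_const h.measurable).compl
  have h0 : μ.map (fun ω => (Y ω, X ω)) {p : E × ℝ | ¬ 0 < g p.1 p.2} = 0 := by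
    rw [h.map_eq, withDensity_apply _ hs, setLIntegral_congr_fun (g := fun _ => 0) hs]
    · simp
    · intro p hp
      exact ENNReal.ofReal_eq_zero.2 (not_lt.1 hp)
  rw [Measure.map_apply (hY.prodMk hX) hs] at h0
  exact h0

variable {m : ℕ} {f : CondDensities m} {X : ℕ → Ω → ℝ}

theorem ae_mem_jointSupport {ν : Measure ℝ} {θ : ℝ} (hX : ∀ i, Measurable (X i))
    (hf : ∀ i, 1 ≤ i →
      IsCondDensity μ ν (fun ω => (past m i).restrict fun j => X j ω) (X i) (f i θ)) (n : ℕ) :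
    ∀ᵐ ω ∂μ, (fun j => X j ω) ∈ jointSupport f n θ := by
  have h : ∀ᵐ ω ∂μ, ∀ i ∈ Finset.Icc 1 n, 0 < condTerm f i θ fun j => X j ω := by
    refine (ae_ball_iff (Finset.countable_toSet _)).2 fun i hi => ?_
    exact (hf i (Finset.mem_Icc.1 hi).1).ae_pos (measurable_pi_lambda _ fun j => hX _) (hX i)
  filter_upwards [h] with ω hω
  exact Finset.prod_pos hω

end

section

variable {Ω : Type*} [MeasurableSpace Ω] {μ : Measure Ω}

theorem eexp_pow_four_rpow (Y : Ω → ℝ) :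
    eexp μ (fun ω => Y ω ^ 4) ^ (1 / 4 : ℝ) = eLpNorm Y 4 μ := by
  rw [eLpNorm_eq_lintegral_rpow_enorm_toReal (by norm_num) (by norm_num)]
  simp only [ENNReal.toReal_ofNat, eexp]
  congr 2 with ω
  rw [Real.enorm_eq_ofReal_abs, ENNReal.ofReal_rpow_of_nonneg (abs_nonneg _) (by norm_num)]
  norm_cast
  rw [Even.pow_abs (by decide)]

theorem eexp_sq_rpow (Y : Ω → ℝ) :
    eexp μ (fun ω => Y ω ^ 2) ^ (1 / 2 : ℝ) = eLpNorm Y 2 μ := by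
  rw [eLpNorm_eq_lintegral_rpow_enorm_toReal (by norm_num) (by norm_num)]
  simp only [ENNReal.toReal_ofNat, eexp]
  congr 2 with ω
  rw [Real.enorm_eq_ofReal_abs, ENNReal.ofReal_rpow_of_nonneg (abs_nonneg _) (by norm_num)]
  norm_cast
  rw [sq_abs]

theorem eexp_pow_four_rpow_half (Y : Ω → ℝ) :
    eexp μ (fun ω => Y ω ^ 4) ^ (1 / 2 : ℝ) = eLpNorm Y 4 μ * eLpNorm Y 4 μ := by
  rw [← eexp_pow_four_rpow, ← ENNReal.rpow_add_of_nonneg _ _ (by norm_num) (by norm_num)]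
  norm_num

theorem integrable_lipschitz_comp [IsProbabilityMeasure μ] {h : ℝ → ℝ} (hh : LipschitzWith 1 h)
    {U : Ω → ℝ} (hU : Integrable U μ) : Integrable (fun ω => h (U ω)) μ := by
  refine (hU.abs.add (integrable_const |h 0|)).mono'
    (hh.continuous.comp_aestronglyMeasurable hU.1) (ae_of_all _ fun ω => ?_)
  have h1 := abs_sub_le_of_lipschitz hh (U ω) 0
  have h2 := abs_sub_abs_le_abs_sub (h (U ω)) (h 0)
  simp only [sub_zero] at h1
  simp only [Real.norm_eq_abs, Pi.add_apply]
  linarith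

theorem enorm_integral_lipschitz_sub_le [IsProbabilityMeasure μ] {h : ℝ → ℝ}
    (hh : LipschitzWith 1 h) {U V : Ω → ℝ} (hU : Integrable U μ) (hV : Integrable V μ) :
    ‖(∫ ω, h (U ω) ∂μ) - ∫ ω, h (V ω) ∂μ‖ₑ ≤ ∫⁻ ω, ‖U ω - V ω‖ₑ ∂μ := by
  rw [← integral_sub (integrable_lipschitz_comp hh hU) (integrable_lipschitz_comp hh hV)]
  refine (enorm_integral_le_lintegral_enorm _).trans (lintegral_mono fun ω => ?_)
  rw [Real.enorm_eq_ofReal_abs, Real.enorm_eq_ofReal_abs]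
  exact ENNReal.ofReal_le_ofReal (abs_sub_le_of_lipschitz hh _ _)

/-- Normal approximation of a sum whose `i`-th term is, almost surely, a function of
`X (i - m), …, X i`, for an `m`-dependent sequence `X`. -/
theorem IsMDependent.enorm_integral_sub_gaussian_le [IsProbabilityMeasure μ] {X : ℕ → Ω → ℝ}
    {m n : ℕ} (hX : ∀ i, Measurable (X i)) (hdep : IsMDependent X m μ) {ψ : ℕ → Ω → ℝ}
    (hψm : ∀ i ∈ Finset.Icc 1 n,
      ∃ g : Ω → ℝ, Measurable[sigmaOf X (window m i)] g ∧ ψ i =ᵐ[μ] g)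
    (hψ : ∀ i ∈ Finset.Icc 1 n, MemLp (ψ i) 4 μ) (hψ0 : ∀ i ∈ Finset.Icc 1 n, ∫ ω, ψ i ω ∂μ = 0)
    (hvar : ∫ ω, (∑ i ∈ Finset.Icc 1 n, ψ i ω) ^ 2 ∂μ = 1)
    {h : ℝ → ℝ} (hh : LipschitzWith 1 h) :
    ‖(∫ ω, h (∑ i ∈ Finset.Icc 1 n, ψ i ω) ∂μ) - ∫ z, h z ∂(gaussianReal 0 1)‖ₑ
      ≤ 2 * (∑ i ∈ Finset.Icc 1 n, ∑ j ∈ nbhd n (2 * m) i, ∑ k ∈ nbhd n (4 * m) i,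
            eLpNorm (ψ i) 4 μ * eLpNorm (ψ j) 4 μ * eLpNorm (ψ k) 4 μ)
        + 2 * (∑ i ∈ Finset.Icc 1 n, ∑ j ∈ nbhd n (2 * m) i, ∑ k ∈ nbhd n (4 * m) i,
            eLpNorm (ψ i) 2 μ * eLpNorm (ψ j) 2 μ * eLpNorm (ψ k) 2 μ)
        + ∑ i ∈ Finset.Icc 1 n, (nbhd n (2 * m) i).card * ∑ j ∈ nbhd n (2 * m) i,
            eLpNorm (ψ i) 2 μ * (eLpNorm (ψ j) 4 μ * eLpNorm (ψ j) 4 μ) := by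
  have hsub : ∀ r, ∀ i ∈ Finset.Icc 1 n, nbhd n r i ⊆ Finset.Icc 1 n := by
    intro r i _ j hj
    simp only [nbhd, Finset.mem_Icc] at hj ⊢
    omega
  have hex : ∃ ζ : ℕ → Ω → ℝ, ∀ i ∈ Finset.Icc 1 n,
      Measurable[sigmaOf X (window m i)] (ζ i) ∧ ψ i =ᵐ[μ] ζ i := by
    choose! ζ hζ using hψm
    exact ⟨ζ, hζ⟩
  obtain ⟨ζ, hζ⟩ := hex
  have hae : ∀ᵐ ω ∂μ, ∀ i ∈ Finset.Icc 1 n, ψ i ω = ζ i ω :=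
    (ae_ball_iff (Finset.countable_toSet _)).2 fun i hi => (hζ i hi).2
  have hsumae : ∀ᵐ ω ∂μ, ∑ i ∈ Finset.Icc 1 n, ψ i ω = ∑ i ∈ Finset.Icc 1 n, ζ i ω := by
    filter_upwards [hae] with ω hω
    exact Finset.sum_congr rfl hω
  have hnorm : ∀ p, ∀ i ∈ Finset.Icc 1 n, eLpNorm (ψ i) p μ = eLpNorm (ζ i) p μ :=
    fun p i hi => eLpNorm_congr_ae (hζ i hi).2
  have hwin : ∀ {i j r : ℕ}, j ∈ nbhd n r i →
      window m j ⊆ {a | 1 ≤ a ∧ i ≤ a + r + m ∧ a ≤ i + r} := by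
    intro i j r hj a ha
    simp only [nbhd, Finset.mem_Icc, window, Set.mem_Icc, Set.mem_ofPred_eq] at hj ha ⊢
    omega
  have hself : ∀ r, ∀ i ∈ Finset.Icc 1 n, i ∈ nbhd n r i := by
    intro r i hi
    simp only [nbhd, Finset.mem_Icc] at hi ⊢
    omega
  have key := enorm_integral_sub_gaussian_le_of_local_dependence (μ := μ) (Finset.Icc 1 n)
    (nbhd n (2 * m)) (nbhd n (4 * m)) (hsub _) (hsub _) (ξ := ζ)
    (fun i hi => (hψ i hi).ae_eq (hζ i hi).2)
    (fun i hi => by rw [← hψ0 i hi]; exact (integral_congr_ae (hζ i hi).2).symm)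
    (by
      rw [← hvar]
      refine integral_congr_ae ?_
      filter_upwards [hsumae] with ω hω
      rw [hω])
    (fun i hi => by
      have h1 := hdep.indepFun_sum_sub_sum_nbhd hX (r := 0) (i := i) (fun j hj => (hζ j hj).1)
        ((hζ i hi).1.mono (sigmaOf_mono X (hwin (hself 0 i hi))) le_rfl)
      rwa [zero_add] at h1)
    (fun i hi => by
      have h1 := hdep.indepFun_sum_sub_sum_nbhd hX (r := 2 * m) (i := i)
        (U := ζ i * ∑ j ∈ nbhd n (2 * m) i, ζ j) (fun j hj => (hζ j hj).1) (by
          refine Measurable.mul ((hζ i hi).1.mono (sigmaOf_mono X (hwin (hself _ i hi))) le_rfl) ?_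
          rw [Finset.sum_fn]
          refine Finset.measurable_sum (M := ℝ) _ fun j hj => ?_
          exact (hζ j (hsub _ i hi hj)).1.mono (sigmaOf_mono X (hwin hj)) le_rfl)
      rwa [show 2 * m + 2 * m = 4 * m by ring] at h1) hh
  have hlhs : ∫ ω, h (∑ i ∈ Finset.Icc 1 n, ψ i ω) ∂μ
      = ∫ ω, h (∑ i ∈ Finset.Icc 1 n, ζ i ω) ∂μ := by
    refine integral_congr_ae ?_
    filter_upwards [hsumae] with ω hω
    rw [hω]
  rw [hlhs]
  refine key.trans (le_of_eq ?_)
  congr 1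
  · congr 1
    · congr 1
      refine Finset.sum_congr rfl fun i hi => Finset.sum_congr rfl fun j hj =>
        Finset.sum_congr rfl fun k hk => ?_
      rw [hnorm 4 i hi, hnorm 4 j (hsub _ i hi hj), hnorm 4 k (hsub _ i hi hk)]
    · congr 1
      refine Finset.sum_congr rfl fun i hi => Finset.sum_congr rfl fun j hj =>
        Finset.sum_congr rfl fun k hk => ?_
      rw [hnorm 2 i hi, hnorm 2 j (hsub _ i hi hj), hnorm 2 k (hsub _ i hi hk)]
  · refine Finset.sum_congr rfl fun i hi => ?_
    congr 1
    refine Finset.sum_congr rfl fun j hj => ?_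
    rw [hnorm 2 i hi, hnorm 4 j (hsub _ i hi hj)]

end

section

variable {m : ℕ} {f : CondDensities m} {Θ : Set ℝ}

theorem uniqueDiffOn_of_nontrivial (hΘ : Θ.OrdConnected) (hnt : Θ.Nontrivial) :
    UniqueDiffOn ℝ Θ := by
  obtain ⟨a, ha, b, hb, hab⟩ := hnt.exists_lt
  refine uniqueDiffOn_convex hΘ.convex ⟨(a + b) / 2, ?_⟩
  refine mem_interior.2 ⟨Set.Ioo a b, Set.Ioo_subset_Icc_self.trans (hΘ.out ha hb), isOpen_Ioo, ?_⟩
  constructor <;> linarith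

theorem logLikDeriv_succ (n k : ℕ) (x : ℕ → ℝ) (θ : ℝ) :
    logLikDeriv f Θ n (k + 1) θ x = derivWithin (fun t => logLikDeriv f Θ n k t x) Θ θ := by
  simp only [logLikDeriv]
  rw [iteratedDerivWithin_succ]

theorem hasDerivWithinAt_logLikDeriv {n k : ℕ} {x : ℕ → ℝ}
    (hd : DifferentiableOn ℝ (fun θ => logLikDeriv f Θ n k θ x) Θ) {θ : ℝ} (hθ : θ ∈ Θ) :
    HasDerivWithinAt (fun t => logLikDeriv f Θ n k t x) (logLikDeriv f Θ n (k + 1) θ x) Θ θ := by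
  rw [logLikDeriv_succ]
  exact (hd θ hθ).hasDerivWithinAt

theorem logLikDeriv_zero (n : ℕ) (x : ℕ → ℝ) (θ : ℝ) :
    logLikDeriv f Θ n 0 θ x = logLik f n θ x := by
  simp [logLikDeriv]

theorem logLikDeriv_one_eq_sum_scoreTerm {n : ℕ} {x : ℕ → ℝ} {θ : ℝ}
    (hd : ∀ i ∈ Finset.Icc 1 n, DifferentiableWithinAt ℝ
      (fun θ => Real.log (condTerm f i θ x)) Θ θ) :
    logLikDeriv f Θ n 1 θ x = ∑ i ∈ Finset.Icc 1 n, scoreTerm f Θ i θ x := by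
  rw [logLikDeriv_succ]
  simp only [logLikDeriv_zero, logLik, scoreTerm]
  exact derivWithin_fun_sum hd

theorem abs_logLikDeriv_three_le {S : Set (ℕ → ℝ)} {n : ℕ} (hfin : supThirdDeriv f Θ S n < ∞)
    {θ : ℝ} (hθ : θ ∈ Θ) {x : ℕ → ℝ} (hx : x ∈ S) :
    |logLikDeriv f Θ n 3 θ x| ≤ (supThirdDeriv f Θ S n).toReal := by
  rw [← ENNReal.ofReal_le_iff_le_toReal hfin.ne]
  exact le_iSup₂_of_le (f := fun θ (_ : θ ∈ Θ) => ⨆ x ∈ S, ENNReal.ofReal |logLikDeriv f Θ n 3 θ x|)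
    θ hθ (le_iSup₂_of_le (f := fun x (_ : x ∈ S) => ENNReal.ofReal |logLikDeriv f Θ n 3 θ x|)
    x hx le_rfl)

/-- Second-order expansion of the score around `θ₀`. -/
theorem abs_score_taylor_le (hΘ : Θ.OrdConnected) {S : Set (ℕ → ℝ)} {n : ℕ}
    (hfin : supThirdDeriv f Θ S n < ∞) {x : ℕ → ℝ} (hx : x ∈ S)
    (hd : ∀ k < 3, DifferentiableOn ℝ (fun θ => logLikDeriv f Θ n k θ x) Θ)
    {θ₀ t : ℝ} (hθ₀ : θ₀ ∈ Θ) (ht : t ∈ Θ) :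
    |logLikDeriv f Θ n 1 t x - logLikDeriv f Θ n 1 θ₀ x - (t - θ₀) * logLikDeriv f Θ n 2 θ₀ x|
      ≤ (supThirdDeriv f Θ S n).toReal / 2 * (t - θ₀) ^ 2 := by
  refine abs_taylor_le_of_lipschitz_deriv hΘ.convex
    (fun θ hθ => hasDerivWithinAt_logLikDeriv (hd 1 (by norm_num)) hθ) hθ₀ ht fun θ hθ => ?_
  exact hΘ.convex.norm_image_sub_le_of_norm_hasDerivWithin_le
    (fun θ hθ => hasDerivWithinAt_logLikDeriv (hd 2 (by norm_num)) hθ)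
    (fun θ hθ => abs_logLikDeriv_three_le hfin hθ hx) hθ₀ hθ

end

section

variable {Ω : Type*} [MeasurableSpace Ω] {μ : Measure Ω}

theorem lintegral_enorm_le_eexp_sq [IsProbabilityMeasure μ] {V W T D : Ω → ℝ} {a b c : ℝ≥0∞}
    (hW : AEStronglyMeasurable W μ) (hT : AEStronglyMeasurable T μ)
    (hD : AEStronglyMeasurable D μ) (hW2 : ∫ ω, W ω ^ 2 ∂μ = 1) (hW2i : Integrable (fun ω => W ω ^ 2) μ)
    (hV : ∀ᵐ ω ∂μ, ‖V ω‖ₑ ≤ a * ‖W ω‖ₑ + b * ENNReal.ofReal (T ω ^ 2) + c * ‖(T * D) ω‖ₑ) :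
    ∫⁻ ω, ‖V ω‖ₑ ∂μ ≤ a + b * eexp μ (fun ω => T ω ^ 2)
      + c * eexp μ (fun ω => T ω ^ 2) ^ (1 / 2 : ℝ) * eexp μ (fun ω => D ω ^ 2) ^ (1 / 2 : ℝ) := by
  have hWnorm : eLpNorm W 1 μ ≤ 1 := by
    refine (eLpNorm_le_eLpNorm_of_exponent_le (q := 2) (by norm_num) hW).trans (le_of_eq ?_)
    rw [← eexp_sq_rpow, eexp, ← ofReal_integral_eq_lintegral_ofReal hW2i
      (ae_of_all _ fun ω => sq_nonneg (W ω)), hW2]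
    simp
  have hTm : AEMeasurable (fun ω => ENNReal.ofReal (T ω ^ 2)) μ :=
    (hT.aemeasurable.pow_const 2).ennreal_ofReal
  refine (lintegral_mono_ae hV).trans ?_
  have hWT : AEMeasurable (fun ω => a * ‖W ω‖ₑ + b * ENNReal.ofReal (T ω ^ 2)) μ :=
    (hW.enorm.const_mul a).add (hTm.const_mul b)
  rw [lintegral_add_left' hWT,
    lintegral_add_left' (hW.enorm.const_mul a), lintegral_const_mul'' _ hW.enorm,
    lintegral_const_mul'' _ hTm, lintegral_const_mul'' _ (hT.mul hD).enorm,
    ← eLpNorm_one_eq_lintegral_enorm, ← eLpNorm_one_eq_lintegral_enorm, eexp_sq_rpow,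
    eexp_sq_rpow, mul_assoc c]
  gcongr
  · exact mul_le_of_le_one_right' hWnorm
  · rfl
  · exact eLpNorm_mul_le hT hD

/-- The algebraic form of the expansion of the standardized estimator `q T` around the
standardized score `s / √v`. -/
theorem abs_mul_sub_standardized_score_le {q v α K s T l₂ : ℝ} (hq : 0 ≤ q) (hv : 0 < v)
    (hα : 0 < α) (h : |0 - s - T * l₂| ≤ K / 2 * T ^ 2) :
    |q * T - s / √v| ≤ |q * √v / α - 1| * |s / √v| + K * (q / (2 * α)) * T ^ 2
      + q / α * |T * (l₂ + α)| := by
  have hv' : 0 < √v := Real.sqrt_pos.2 hv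
  have e : q * T - s / √v = (q * √v / α - 1) * (s / √v) + q / α * (0 - s - T * l₂)
      + q / α * (T * (l₂ + α)) := by
    field_simp
    ring
  rw [e]
  refine (abs_add_three _ _ _).trans ?_
  rw [abs_mul, abs_mul, abs_mul (q / α) (T * (l₂ + α)), abs_of_nonneg (div_nonneg hq hα.le)]
  have h' : q / α * |0 - s - T * l₂| ≤ K * (q / (2 * α)) * T ^ 2 := by
    calc q / α * |0 - s - T * l₂| ≤ q / α * (K / 2 * T ^ 2) := by gcongr
      _ = _ := by field_simp
  linarith

theorem enorm_mul_sub_standardized_score_le {q v α s T l₂ : ℝ} {K : ℝ≥0∞} (hK : K ≠ ∞)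
    (hq : 0 ≤ q) (hv : 0 < v) (hα : 0 < α) (h : |0 - s - T * l₂| ≤ K.toReal / 2 * T ^ 2) :
    ‖q * T - s / √v‖ₑ ≤ ENNReal.ofReal |q * √v / α - 1| * ‖s / √v‖ₑ
      + K * ENNReal.ofReal (q / (2 * α)) * ENNReal.ofReal (T ^ 2)
      + ENNReal.ofReal (q / α) * ‖T * (l₂ + α)‖ₑ := by
  have h1 := ENNReal.ofReal_le_ofReal (abs_mul_sub_standardized_score_le hq hv hα h)
  simp only [Real.enorm_eq_ofReal_abs]
  rw [← ENNReal.ofReal_toReal hK]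
  rw [← ENNReal.ofReal_mul (abs_nonneg _), ← ENNReal.ofReal_mul ENNReal.toReal_nonneg,
    ← ENNReal.ofReal_mul (by positivity), ← ENNReal.ofReal_mul (by positivity),
    ← ENNReal.ofReal_add (by positivity) (by positivity),
    ← ENNReal.ofReal_add (by positivity) (by positivity)]
  exact h1

variable {m : ℕ} {f : CondDensities m} {X : ℕ → Ω → ℝ} {Θ : Set ℝ}

theorem nontrivial_of_variance_logLikDeriv_pos {n : ℕ} {θ : ℝ} (hθ : θ ∈ Θ)
    (h : 0 < variance (fun ω => logLikDeriv f Θ n 1 θ fun j => X j ω) μ) : Θ.Nontrivial := by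
  by_contra hnt
  rw [Set.not_nontrivial_iff] at hnt
  have hΘ : Θ = {θ} := hnt.eq_singleton_of_mem hθ
  have h0 : (fun ω => logLikDeriv f Θ n 1 θ fun j => X j ω) = 0 := by
    funext ω
    rw [logLikDeriv_succ, hΘ, derivWithin_zero_of_not_accPt]
    · rfl
    · rw [accPt_principal_iff_nhdsWithin]
      simp
  rw [h0, variance_zero] at h
  exact lt_irrefl _ h

/-- Almost sure measurability of the second derivative of the log-likelihood along the sample. -/
theorem aestronglyMeasurable_logLikDeriv_two {n : ℕ} {S : Set (ℕ → ℝ)} {θ₀ : ℝ}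
    (hX : ∀ i, Measurable (X i)) (hΘ : UniqueDiffOn ℝ Θ) (hθ₀ : θ₀ ∈ Θ)
    (hf : ∀ θ ∈ Θ, ∀ i, 1 ≤ i → Measurable (Function.uncurry (f i θ)))
    (hd : ∀ x ∈ S, ∀ k < 3, DifferentiableOn ℝ (fun θ => logLikDeriv f Θ n k θ x) Θ)
    (hS : ∀ᵐ ω ∂μ, (fun j => X j ω) ∈ S) :
    AEStronglyMeasurable (fun ω => logLikDeriv f Θ n 2 θ₀ fun j => X j ω) μ := by
  have h0 : ∀ θ ∈ Θ, ∃ g : Ω → ℝ, Measurable g ∧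
      (fun ω => logLikDeriv f Θ n 0 θ fun j => X j ω) =ᵐ[μ] g := by
    intro θ hθ
    refine ⟨_, ?_, EventuallyEq.rfl⟩
    simp only [logLikDeriv_zero, logLik]
    refine Finset.measurable_sum _ fun i hi => Real.measurable_log.comp ?_
    have hi' := (Finset.mem_Icc.1 hi).1
    exact (measurable_sigmaOf_condTerm hi' (hf θ hθ i hi')).mono (sigmaOf_le hX _) le_rfl
  have hstep : ∀ k < 3, (∀ θ ∈ Θ, ∃ g : Ω → ℝ, Measurable g ∧
      (fun ω => logLikDeriv f Θ n k θ fun j => X j ω) =ᵐ[μ] g) →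
      ∀ θ ∈ Θ, ∃ g : Ω → ℝ, Measurable g ∧
      (fun ω => logLikDeriv f Θ n (k + 1) θ fun j => X j ω) =ᵐ[μ] g := by
    intro k hk h θ hθ
    simp only [logLikDeriv_succ]
    refine exists_measurable_ae_eq_derivWithin hθ (hΘ θ hθ)
      (F := fun θ ω => logLikDeriv f Θ n k θ fun j => X j ω) h ?_
    filter_upwards [hS] with ω hω
    exact hd _ hω k hk θ hθ
  obtain ⟨g, hg, hge⟩ := hstep 1 (by norm_num) (hstep 0 (by norm_num) h0) θ₀ hθ₀
  exact hg.aestronglyMeasurable.congr hge.symm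

/-- If some fourth moment is infinite, so is the sum over triples. -/
theorem sum_eexp_pow_four_eq_top {n a b : ℕ} {ξ : ℕ → Ω → ℝ} {i : ℕ} (hi : i ∈ Finset.Icc 1 n)
    (h : eLpNorm (ξ i) 4 μ = ∞) :
    ∑ i ∈ Finset.Icc 1 n, ∑ j ∈ nbhd n a i, ∑ k ∈ nbhd n b i,
      (eexp μ (fun ω => ξ i ω ^ 4) * eexp μ (fun ω => ξ j ω ^ 4) *
        eexp μ (fun ω => ξ k ω ^ 4)) ^ (1 / 4 : ℝ) = ∞ := by
  have hself : ∀ r, i ∈ nbhd n r i := by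
    intro r
    simp only [nbhd, Finset.mem_Icc] at hi ⊢
    omega
  refine ENNReal.sum_eq_top.2 ⟨i, hi, ENNReal.sum_eq_top.2 ⟨i, hself a, ENNReal.sum_eq_top.2
    ⟨i, hself b, ?_⟩⟩⟩
  rw [ENNReal.mul_rpow_of_nonneg _ _ (by norm_num), ENNReal.mul_rpow_of_nonneg _ _ (by norm_num),
    eexp_pow_four_rpow, h]
  simp

/-- The bound of the normal approximation for the terms `ξ i / √n`, in terms of the moments of
the `ξ i`. -/
theorem stein_bound_scaled {n m : ℕ} {ξ : ℕ → Ω → ℝ} :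
    2 * (∑ i ∈ Finset.Icc 1 n, ∑ j ∈ nbhd n (2 * m) i, ∑ k ∈ nbhd n (4 * m) i,
            eLpNorm ((√(n : ℝ))⁻¹ • ξ i) 4 μ * eLpNorm ((√(n : ℝ))⁻¹ • ξ j) 4 μ
              * eLpNorm ((√(n : ℝ))⁻¹ • ξ k) 4 μ)
        + 2 * (∑ i ∈ Finset.Icc 1 n, ∑ j ∈ nbhd n (2 * m) i, ∑ k ∈ nbhd n (4 * m) i,
            eLpNorm ((√(n : ℝ))⁻¹ • ξ i) 2 μ * eLpNorm ((√(n : ℝ))⁻¹ • ξ j) 2 μ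
              * eLpNorm ((√(n : ℝ))⁻¹ • ξ k) 2 μ)
        + ∑ i ∈ Finset.Icc 1 n, ((nbhd n (2 * m) i).card : ℝ≥0∞) * ∑ j ∈ nbhd n (2 * m) i,
            eLpNorm ((√(n : ℝ))⁻¹ • ξ i) 2 μ * (eLpNorm ((√(n : ℝ))⁻¹ • ξ j) 4 μ
              * eLpNorm ((√(n : ℝ))⁻¹ • ξ j) 4 μ)
      = ENNReal.ofReal (2 / (n : ℝ) ^ (3 / 2 : ℝ)) *
          ∑ i ∈ Finset.Icc 1 n, ∑ j ∈ nbhd n (2 * m) i, ∑ k ∈ nbhd n (4 * m) i,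
            (eexp μ (fun ω => ξ i ω ^ 4) * eexp μ (fun ω => ξ j ω ^ 4) *
              eexp μ (fun ω => ξ k ω ^ 4)) ^ (1 / 4 : ℝ)
        + ENNReal.ofReal (2 / (n : ℝ) ^ (3 / 2 : ℝ)) *
          ∑ i ∈ Finset.Icc 1 n, ∑ j ∈ nbhd n (2 * m) i, ∑ k ∈ nbhd n (4 * m) i,
            (eexp μ (fun ω => ξ i ω ^ 2) * eexp μ (fun ω => ξ j ω ^ 2) *
              eexp μ (fun ω => ξ k ω ^ 2)) ^ (1 / 2 : ℝ)
        + ENNReal.ofReal (1 / (n : ℝ) ^ (3 / 2 : ℝ)) *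
          ∑ i ∈ Finset.Icc 1 n, ((nbhd n (2 * m) i).card : ℝ≥0∞) *
            ∑ j ∈ nbhd n (2 * m) i,
              (eexp μ (fun ω => ξ i ω ^ 2) * eexp μ (fun ω => ξ j ω ^ 4)) ^ (1 / 2 : ℝ) := by
  have hc : ENNReal.ofReal (1 / (n : ℝ) ^ (3 / 2 : ℝ))
      = ‖(√(n : ℝ))⁻¹‖ₑ * ‖(√(n : ℝ))⁻¹‖ₑ * ‖(√(n : ℝ))⁻¹‖ₑ := by
    rw [← enorm_mul, ← enorm_mul, Real.enorm_eq_ofReal_abs, abs_of_nonneg (by positivity)]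
    congr 1
    rw [Real.sqrt_eq_rpow, ← mul_inv, ← mul_inv, ← Real.rpow_add_of_nonneg (by positivity)
      (by norm_num) (by norm_num), ← Real.rpow_add_of_nonneg (by positivity)
      (by norm_num) (by norm_num), one_div]
    norm_num
  have hc2 : ENNReal.ofReal (2 / (n : ℝ) ^ (3 / 2 : ℝ))
      = 2 * ENNReal.ofReal (1 / (n : ℝ) ^ (3 / 2 : ℝ)) := by
    rw [← ENNReal.ofReal_ofNat 2, ← ENNReal.ofReal_mul (by norm_num)]
    congr 1
    ring
  have hquarter : (0 : ℝ) ≤ 1 / 4 := by norm_num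
  have hhalf : (0 : ℝ) ≤ 1 / 2 := by norm_num
  simp only [ENNReal.mul_rpow_of_nonneg _ _ hquarter, ENNReal.mul_rpow_of_nonneg _ _ hhalf,
    eexp_pow_four_rpow, eexp_sq_rpow, eexp_pow_four_rpow_half, eLpNorm_const_smul, hc2, hc,
    mul_assoc (2 : ℝ≥0∞), ← mul_add (2 : ℝ≥0∞)]
  congr 1
  · congr 1
    congr 1 <;>
    · simp only [Finset.mul_sum]
      refine Finset.sum_congr rfl fun i _ => Finset.sum_congr rfl fun j _ =>
        Finset.sum_congr rfl fun k _ => ?_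
      ring
  · simp only [Finset.mul_sum]
    refine Finset.sum_congr rfl fun i _ => Finset.sum_congr rfl fun j _ => ?_
    ring

end

end MDepMLE

open MDepMLE in
/-- Wasserstein bound for the normal approximation of the maximum likelihood estimator of a
scalar parameter from `m`-dependent identically distributed observations. Both sides are
elements of `[0, ∞]`, so that no moment has to be assumed finite beyond the variances that
make `α` finite and nonzero. -/
theorem wasserstein_bound_mle_m_dependent
    {Ω : Type*} [MeasurableSpace Ω]
    -- the parameter space, an interval, and the statistical model
    (Θ : Set ℝ) (hΘ : Θ.OrdConnected)
    (P : Θ → Measure Ω) [∀ θ, IsProbabilityMeasure (P θ)]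
    (X : ℕ → Ω → ℝ) (hX : ∀ i, Measurable (X i))
    (m : ℕ) (ν : Measure ℝ) [SigmaFinite ν] (f : CondDensities m)
    (hf : ∀ (θ : Θ) (i : ℕ), 1 ≤ i →
      IsCondDensity (P θ) ν (fun ω => (past m i).restrict fun j => X j ω) (X i) (f i θ))
    -- under the true parameter, the sequence is `m`-dependent and identically distributed
    (θ₀ : Θ) (hdep : IsMDependent X m (P θ₀))
    (hid : ∀ i j : ℕ, 1 ≤ i → 1 ≤ j → IdentDistrib (X i) (X j) (P θ₀) (P θ₀))
    (n : ℕ) (hn : 1 ≤ n)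
    -- the support of the joint density, common to all parameters
    (S : Set (ℕ → ℝ)) (hS : ∀ θ ∈ Θ, jointSupport f n θ = S)
    -- the MLE exists and is unique, for the sample size `n` and for all large sample sizes,
    -- and it solves the likelihood equation
    (mle : (N : ℕ) → (Finset.Icc 1 N → ℝ) → ℝ) (hmle_meas : ∀ N, Measurable (mle N))
    (est : ℕ → Ω → ℝ)
    (hest : ∀ N ω, est N ω = mle N ((Finset.Icc 1 N).restrict fun j => X j ω))
    (hmle : ∀ᵐ ω ∂(P θ₀), IsUniqueMLE f Θ n (fun j => X j ω) (est n ω))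
    (hmle_large : ∀ᶠ N in atTop,
      ∀ᵐ ω ∂(P θ₀), IsUniqueMLE f Θ N (fun j => X j ω) (est N ω))
    (hstat : ∀ᵐ ω ∂(P θ₀), logLikDeriv f Θ n 1 (est n ω) (fun j => X j ω) = 0)
    -- (A.D.1)
    (hAD1 : ∀ x ∈ S, ∀ k < 3, DifferentiableOn ℝ (fun θ => logLikDeriv f Θ n k θ x) Θ)
    (hAD1' : supThirdDeriv f Θ S n < ∞)
    -- (A.D.2): the score terms at the true parameter exist and have mean zero
    (hAD2 : ∀ i ∈ Finset.Icc 1 n, ∀ᵐ ω ∂(P θ₀), DifferentiableWithinAt ℝ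
      (fun θ => Real.log (condTerm f i θ fun j => X j ω)) Θ θ₀)
    (hAD2' : ∀ i ∈ Finset.Icc 1 n,
      Integrable (fun ω => scoreTerm f Θ i θ₀ fun j => X j ω) (P θ₀) ∧
        ∫ ω, scoreTerm f Θ i θ₀ (fun j => X j ω) ∂(P θ₀) = 0)
    -- (A.D.4)
    (i₂ : ℝ)
    (hAD4 : Tendsto (fun N : ℕ => 1 / ((N : ℝ) * variance (est N) (P θ₀))) atTop (𝓝 i₂))
    (hi₂ : 0 < i₂)
    -- the variance of the score, and `α` (with the conventions `variance = 0` for infinite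
    -- variance and `a / 0 = 0`, the two conditions say that both variances are finite and
    -- positive, i.e. that `α` is finite and nonzero)
    (vl : ℝ) (hvl : vl = variance (fun ω => logLikDeriv f Θ n 1 θ₀ fun j => X j ω) (P θ₀))
    (hvl_pos : 0 < vl)
    (α : ℝ) (hα : α = √(vl / variance (est n) (P θ₀))) (hα_ne : α ≠ 0)
    -- the scaled score terms
    (ξ : ℕ → Ω → ℝ)
    (hξ : ∀ i ω, ξ i ω = scoreTerm f Θ i θ₀ (fun j => X j ω) * √((n : ℝ) / vl)) :
    wassersteinDist ((P θ₀).map fun ω => √((n : ℝ) * i₂) * (est n ω - θ₀)) (gaussianReal 0 1) ≤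
      ENNReal.ofReal (2 / (n : ℝ) ^ (3 / 2 : ℝ)) *
          ∑ i ∈ Finset.Icc 1 n, ∑ j ∈ nbhd n (2 * m) i, ∑ k ∈ nbhd n (4 * m) i,
            (eexp (P θ₀) (fun ω => ξ i ω ^ 4) * eexp (P θ₀) (fun ω => ξ j ω ^ 4) *
              eexp (P θ₀) (fun ω => ξ k ω ^ 4)) ^ (1 / 4 : ℝ)
        + ENNReal.ofReal (2 / (n : ℝ) ^ (3 / 2 : ℝ)) *
          ∑ i ∈ Finset.Icc 1 n, ∑ j ∈ nbhd n (2 * m) i, ∑ k ∈ nbhd n (4 * m) i,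
            (eexp (P θ₀) (fun ω => ξ i ω ^ 2) * eexp (P θ₀) (fun ω => ξ j ω ^ 2) *
              eexp (P θ₀) (fun ω => ξ k ω ^ 2)) ^ (1 / 2 : ℝ)
        + ENNReal.ofReal (1 / (n : ℝ) ^ (3 / 2 : ℝ)) *
          ∑ i ∈ Finset.Icc 1 n, ((nbhd n (2 * m) i).card : ℝ≥0∞) *
            ∑ j ∈ nbhd n (2 * m) i,
              (eexp (P θ₀) (fun ω => ξ i ω ^ 2) * eexp (P θ₀) (fun ω => ξ j ω ^ 4)) ^ (1 / 2 : ℝ)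
        + ENNReal.ofReal |√((n : ℝ) * i₂ * vl) / α - 1|
        + supThirdDeriv f Θ S n * ENNReal.ofReal (√((n : ℝ) * i₂) / (2 * α)) *
          eexp (P θ₀) (fun ω => (est n ω - θ₀) ^ 2)
        + ENNReal.ofReal (√((n : ℝ) * i₂) / α) *
          eexp (P θ₀) (fun ω => (est n ω - θ₀) ^ 2) ^ (1 / 2 : ℝ) *
          eexp (P θ₀) (fun ω => (logLikDeriv f Θ n 2 θ₀ (fun j => X j ω) + α) ^ 2) ^
            (1 / 2 : ℝ) := by
  have hθ₀ : (θ₀ : ℝ) ∈ Θ := θ₀.2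
  set μ : Measure Ω := P θ₀ with hμ
  have hn0 : (0 : ℝ) < n := by exact_mod_cast hn
  have hvar_ne : variance (est n) μ ≠ 0 := by
    intro h0
    rw [h0, div_zero, Real.sqrt_zero] at hα
    exact hα_ne hα
  have hα0 : 0 < α := lt_of_le_of_ne (hα ▸ Real.sqrt_nonneg _) hα_ne.symm
  have hΘu : UniqueDiffOn ℝ Θ := uniqueDiffOn_of_nontrivial hΘ
    (nontrivial_of_variance_logLikDeriv_pos hθ₀ (hvl ▸ hvl_pos))
  have hest_meas : Measurable (est n) := by
    have : est n = fun ω => mle n ((Finset.Icc 1 n).restrict fun j => X j ω) :=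
      funext (hest n)
    rw [this]
    exact (hmle_meas n).comp (measurable_pi_lambda _ fun j => hX _)
  have hest2 : MemLp (fun ω => est n ω - θ₀) 2 μ :=
    (memLp_two_of_variance_ne_zero hest_meas.aestronglyMeasurable hvar_ne).sub (memLp_const _)
  have hXS : ∀ᵐ ω ∂μ, (fun j => X j ω) ∈ S := by
    rw [← hS θ₀ hθ₀]
    exact ae_mem_jointSupport hX (hf θ₀) n
  have hscore : ∀ᵐ ω ∂μ, logLikDeriv f Θ n 1 θ₀ (fun j => X j ω)
      = ∑ i ∈ Finset.Icc 1 n, scoreTerm f Θ i θ₀ fun j => X j ω := by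
    filter_upwards [(ae_ball_iff (Finset.countable_toSet _)).2 hAD2] with ω hω
    exact logLikDeriv_one_eq_sum_scoreTerm hω
  have hl₂ : AEStronglyMeasurable (fun ω => logLikDeriv f Θ n 2 θ₀ (fun j => X j ω) + α) μ :=
    (aestronglyMeasurable_logLikDeriv_two hX hΘu hθ₀
      (fun θ hθ i hi => (hf ⟨θ, hθ⟩ i hi).measurable) hAD1 hXS).add aestronglyMeasurable_const
  have hξeq : ∀ i, ξ i = √((n : ℝ) / vl) • fun ω => scoreTerm f Θ i θ₀ fun j => X j ω := fun i => by
    funext ω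
    rw [hξ, Pi.smul_apply, smul_eq_mul, mul_comm]
  have hξm : ∀ i ∈ Finset.Icc 1 n, ∃ g : Ω → ℝ, Measurable[sigmaOf X (window m i)] g ∧
      (√(n : ℝ))⁻¹ • ξ i =ᵐ[μ] g := by
    intro i hi
    have hi' := (Finset.mem_Icc.1 hi).1
    obtain ⟨g, hg, hge⟩ := exists_measurable_ae_eq_derivWithin (μ := μ) hθ₀ (hΘu θ₀ hθ₀)
      (F := fun θ ω => Real.log (condTerm f i θ fun j => X j ω))
      (fun θ hθ => ⟨_, Real.measurable_log.comp
        (measurable_sigmaOf_condTerm hi' (hf ⟨θ, hθ⟩ i hi').measurable), EventuallyEq.rfl⟩)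
      (hAD2 i hi)
    refine ⟨(√(n : ℝ))⁻¹ • √((n : ℝ) / vl) • g, (hg.const_smul _).const_smul _, ?_⟩
    rw [hξeq]
    filter_upwards [hge] with ω hω
    simp only [Pi.smul_apply, ← hω]
    rfl
  by_cases hfour : ∀ i ∈ Finset.Icc 1 n, eLpNorm (ξ i) 4 μ < ∞
  swap
  · push Not at hfour
    obtain ⟨i, hi, htop⟩ := hfour
    rw [sum_eexp_pow_four_eq_top hi (top_le_iff.1 htop),
      ENNReal.mul_top (by simpa using Real.rpow_pos_of_pos hn0 _)]
    simp
  have hξ4 : ∀ i ∈ Finset.Icc 1 n, MemLp ((√(n : ℝ))⁻¹ • ξ i) 4 μ := by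
    intro i hi
    refine MemLp.const_smul ⟨?_, hfour i hi⟩ _
    rw [hξeq]
    exact (hAD2' i hi).1.1.const_smul _
  have hξ0 : ∀ i ∈ Finset.Icc 1 n, ∫ ω, ((√(n : ℝ))⁻¹ • ξ i) ω ∂μ = 0 := by
    intro i hi
    simp only [hξeq, Pi.smul_apply, smul_eq_mul, integral_const_mul, (hAD2' i hi).2, mul_zero]
  set W : Ω → ℝ := fun ω => logLikDeriv f Θ n 1 θ₀ (fun j => X j ω) / √vl with hWdef
  have hWsum : ∀ᵐ ω ∂μ, ∑ i ∈ Finset.Icc 1 n, ((√(n : ℝ))⁻¹ • ξ i) ω = W ω := by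
    filter_upwards [hscore] with ω hω
    simp only [hWdef, hω, Pi.smul_apply, smul_eq_mul, hξ, Finset.sum_div]
    refine Finset.sum_congr rfl fun i _ => ?_
    rw [Real.sqrt_div hn0.le]
    have h1 : 0 < √(n : ℝ) := Real.sqrt_pos.2 hn0
    have h2 : 0 < √vl := Real.sqrt_pos.2 hvl_pos
    field_simp
  have hW4 : MemLp W 4 μ := (memLp_finsetSum _ hξ4).ae_eq hWsum
  have hWi : Integrable W μ := hW4.integrable (by norm_num)
  have hW2i : Integrable (fun ω => W ω ^ 2) μ :=
    (hW4.mono_exponent (p := 2) (by norm_num)).integrable_sq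
  have hW0 : ∫ ω, W ω ∂μ = 0 := by
    rw [← integral_congr_ae hWsum, integral_finsetSum _ fun i hi =>
      (hξ4 i hi).integrable (by norm_num)]
    exact Finset.sum_eq_zero hξ0
  have hW2 : ∫ ω, W ω ^ 2 ∂μ = 1 := by
    rw [← variance_of_integral_eq_zero hWi.1.aemeasurable hW0]
    have : W = fun ω => (√vl)⁻¹ * logLikDeriv f Θ n 1 θ₀ (fun j => X j ω) := by
      funext ω
      exact div_eq_inv_mul _ _
    rw [this, variance_const_mul, ← hvl, inv_pow, Real.sq_sqrt hvl_pos.le,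
      inv_mul_cancel₀ hvl_pos.ne']
  have hvarsum : ∫ ω, (∑ i ∈ Finset.Icc 1 n, ((√(n : ℝ))⁻¹ • ξ i) ω) ^ 2 ∂μ = 1 := by
    rw [← hW2]
    refine integral_congr_ae ?_
    filter_upwards [hWsum] with ω hω
    rw [hω]
  have hUi : Integrable (fun ω => √((n : ℝ) * i₂) * (est n ω - θ₀)) μ :=
    (hest2.integrable (by norm_num)).const_mul _
  have hrem : ∫⁻ ω, ‖√((n : ℝ) * i₂) * (est n ω - θ₀) - W ω‖ₑ ∂μ
      ≤ ENNReal.ofReal |√((n : ℝ) * i₂ * vl) / α - 1|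
        + supThirdDeriv f Θ S n * ENNReal.ofReal (√((n : ℝ) * i₂) / (2 * α)) *
          eexp μ (fun ω => (est n ω - θ₀) ^ 2)
        + ENNReal.ofReal (√((n : ℝ) * i₂) / α) *
          eexp μ (fun ω => (est n ω - θ₀) ^ 2) ^ (1 / 2 : ℝ) *
          eexp μ (fun ω => (logLikDeriv f Θ n 2 θ₀ (fun j => X j ω) + α) ^ 2) ^ (1 / 2 : ℝ) := by
    refine lintegral_enorm_le_eexp_sq hWi.1 hest2.1 hl₂ hW2 hW2i ?_
    filter_upwards [hXS, hmle, hstat] with ω hx ht hz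
    have htaylor := abs_score_taylor_le hΘ hAD1' hx (hAD1 _ hx) hθ₀ ht.1
    rw [hz] at htaylor
    rw [Real.sqrt_mul (by positivity) vl]
    exact enorm_mul_sub_standardized_score_le hAD1'.ne (Real.sqrt_nonneg _) hvl_pos hα0 htaylor
  refine iSup₂_le fun h hh => ?_
  rw [integral_map hUi.1.aemeasurable hh.continuous.aestronglyMeasurable, ← Real.enorm_eq_ofReal_abs]
  have hWh : ∫ ω, h (W ω) ∂μ
      = ∫ ω, h (∑ i ∈ Finset.Icc 1 n, ((√(n : ℝ))⁻¹ • ξ i) ω) ∂μ := by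
    refine integral_congr_ae ?_
    filter_upwards [hWsum] with ω hω
    rw [hω]
  have hstein := hdep.enorm_integral_sub_gaussian_le hX (ψ := fun i => (√(n : ℝ))⁻¹ • ξ i)
    hξm hξ4 hξ0 hvarsum hh
  rw [← hWh, stein_bound_scaled] at hstein
  have hsplit : (∫ ω, h (√((n : ℝ) * i₂) * (est n ω - θ₀)) ∂μ) - ∫ z, h z ∂(gaussianReal 0 1)
      = ((∫ ω, h (W ω) ∂μ) - ∫ z, h z ∂(gaussianReal 0 1))
        + ((∫ ω, h (√((n : ℝ) * i₂) * (est n ω - θ₀)) ∂μ) - ∫ ω, h (W ω) ∂μ) := by ring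
  rw [hsplit]
  refine (enorm_add_le _ _).trans ((add_le_add hstein
    ((enorm_integral_lipschitz_sub_le hh hUi hWi).trans hrem)).trans (le_of_eq ?_))
  simp only [add_assoc]
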